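/- arXiv:1812.03766 — 4 statements merged into one kernel-verified Lean document; each statement's English description precedes it below -/
import Mathlib

section
/- Let a, b ≥ 0 with a + b = λ ≤ 1, let C(u,v) = min{u, v, u^(1-a) · v^(1-b)} on [0,1]², and let μ be the probability measure on [0,1]² satisfying μ([0,u]×[0,v]) = C(u,v) for all u, v ∈ [0,1]. Then Kendall's coefficient τ = 4∫ C dμ − 1 equals λ. -/
open MeasureTheory Filter Set Real

noncomputable section

open scoped ENNReal Topology

/-- A function increasing at rate at most one is recovered from its derivative. -/
lemma lintegral_deriv_eq_sub {f : ℝ → ℝ}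
    (hf : ∀ x y, 0 ≤ x → x ≤ y → y ≤ 1 → 0 ≤ f y - f x ∧ f y - f x ≤ y - x)
    {x y : ℝ} (hx : 0 ≤ x) (hxy : x ≤ y) (hy : y ≤ 1) :
    ∫⁻ t in Icc x y, ENNReal.ofReal (deriv f t) = ENNReal.ofReal (f y - f x) := by
  have hlip : LipschitzOnWith 1 f (uIcc x y) := by
    rw [uIcc_of_le hxy]
    refine LipschitzOnWith.of_le_add fun s hs t ht => ?_
    rw [Real.dist_eq]
    rcases le_total s t with h | h
    · have := hf s t (hx.trans hs.1) h (ht.2.trans hy)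
      linarith [abs_nonneg (s - t)]
    · have := hf t s (hx.trans ht.1) h (hs.2.trans hy)
      linarith [le_abs_self (s - t)]
  have hmono : MonotoneOn f (Icc x y) := fun s hs t ht h => by
    linarith [(hf s t (hx.trans hs.1) h (ht.2.trans hy)).1]
  have hac := hlip.absolutelyContinuousOnInterval
  have hint := hac.intervalIntegrable_deriv
  rw [intervalIntegrable_iff_integrableOn_Ioo_of_le hxy] at hint
  rw [← hac.integral_deriv_eq_sub, intervalIntegral.integral_of_le hxy,
    integral_Ioc_eq_integral_Ioo, ← restrict_Ioo_eq_restrict_Icc,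
    ofReal_integral_eq_lintegral_ofReal hint]
  filter_upwards [ae_restrict_mem measurableSet_Ioo] with t ht
  rw [← derivWithin_of_mem_nhds (Icc_mem_nhds ht.1 ht.2)]
  exact hmono.derivWithin_nonneg

/-- `C` is continuous, agrees with the distribution function of `μ` on the unit square, and has
uniform margins. -/
structure IsCopulaOf (C : ℝ → ℝ → ℝ) (μ : Measure (ℝ × ℝ)) : Prop where
  continuous : Continuous C.uncurry
  nonneg : ∀ u ∈ Icc (0 : ℝ) 1, ∀ v ∈ Icc (0 : ℝ) 1, 0 ≤ C u v
  margin_left : ∀ u ∈ Icc (0 : ℝ) 1, C u 1 = u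
  margin_right : ∀ v ∈ Icc (0 : ℝ) 1, C 1 v = v
  measure_rect : ∀ u ∈ Icc (0 : ℝ) 1, ∀ v ∈ Icc (0 : ℝ) 1,
    μ (Icc 0 u ×ˢ Icc 0 v) = ENNReal.ofReal (C u v)

namespace IsCopulaOf

variable {C : ℝ → ℝ → ℝ} {μ : Measure (ℝ × ℝ)}

lemma swap (h : IsCopulaOf C μ) : IsCopulaOf (fun u v => C v u) (μ.map Prod.swap) where
  continuous := h.continuous.comp continuous_swap
  nonneg u hu v hv := h.nonneg v hv u hu
  margin_left := h.margin_right
  margin_right := h.margin_left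
  measure_rect u hu v hv := by
    rw [Measure.map_apply measurable_swap (measurableSet_Icc.prod measurableSet_Icc),
      preimage_swap_prod, h.measure_rect v hv u hu]

lemma sub_mem_Icc_left (h : IsCopulaOf C μ) {v : ℝ} (hv : v ∈ Icc (0 : ℝ) 1) (x y : ℝ)
    (hx : 0 ≤ x) (hxy : x ≤ y) (hy : y ≤ 1) : 0 ≤ C y v - C x v ∧ C y v - C x v ≤ y - x := by
  have hx' : x ∈ Icc (0 : ℝ) 1 := ⟨hx, hxy.trans hy⟩
  have hy' : y ∈ Icc (0 : ℝ) 1 := ⟨hx.trans hxy, hy⟩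
  have h1 : (1 : ℝ) ∈ Icc (0 : ℝ) 1 := by simp
  constructor
  · have hle : μ (Icc 0 x ×ˢ Icc 0 v) ≤ μ (Icc 0 y ×ˢ Icc 0 v) :=
      measure_mono (prod_mono (Icc_subset_Icc_right hxy) subset_rfl)
    rw [h.measure_rect x hx' v hv, h.measure_rect y hy' v hv,
      ENNReal.ofReal_le_ofReal_iff (h.nonneg y hy' v hv)] at hle
    linarith
  · have hunion := measure_union_add_inter (μ := μ) (Icc 0 y ×ˢ Icc 0 v)
      ((measurableSet_Icc (a := (0 : ℝ)) (b := x)).prod (measurableSet_Icc (a := (0 : ℝ)) (b := 1)))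
    have hinter : (Icc (0 : ℝ) y ×ˢ Icc (0 : ℝ) v) ∩ (Icc 0 x ×ˢ Icc 0 1) =
        Icc 0 x ×ˢ Icc 0 v := by
      rw [prod_inter_prod, Icc_inter_Icc, Icc_inter_Icc]
      simp [hxy, hv.2]
    have hle : μ ((Icc 0 y ×ˢ Icc 0 v) ∪ (Icc 0 x ×ˢ Icc 0 1)) ≤ μ (Icc 0 y ×ˢ Icc 0 1) :=
      measure_mono (union_subset (prod_mono subset_rfl (Icc_subset_Icc_right hv.2))
        (prod_mono (Icc_subset_Icc_right hxy) subset_rfl))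
    have hle' := add_le_add_left hle (μ (Icc 0 x ×ˢ Icc 0 v))
    rw [← hinter, hunion, hinter, h.measure_rect x hx' v hv, h.measure_rect y hy' v hv,
      h.measure_rect x hx' 1 h1, h.measure_rect y hy' 1 h1, h.margin_left x hx',
      h.margin_left y hy', ← ENNReal.ofReal_add (h.nonneg y hy' v hv) hx,
      ← ENNReal.ofReal_add hy'.1 (h.nonneg x hx' v hv),
      ENNReal.ofReal_le_ofReal_iff (add_nonneg hy'.1 (h.nonneg x hx' v hv))] at hle'
    linarith

lemma sub_mem_Icc_right (h : IsCopulaOf C μ) {u : ℝ} (hu : u ∈ Icc (0 : ℝ) 1) (x y : ℝ)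
    (hx : 0 ≤ x) (hxy : x ≤ y) (hy : y ≤ 1) : 0 ≤ C u y - C u x ∧ C u y - C u x ≤ y - x :=
  h.swap.sub_mem_Icc_left hu x y hx hxy hy

lemma zero_left (h : IsCopulaOf C μ) {v : ℝ} (hv : v ∈ Icc (0 : ℝ) 1) : C 0 v = 0 := by
  have h0 : (0 : ℝ) ∈ Icc (0 : ℝ) 1 := by simp
  have h1 := (h.sub_mem_Icc_right h0 v 1 hv.1 hv.2 le_rfl).1
  rw [h.margin_left 0 h0] at h1
  linarith [h.nonneg 0 h0 v hv]

lemma le_left (h : IsCopulaOf C μ) {u v : ℝ} (hu : u ∈ Icc (0 : ℝ) 1) (hv : v ∈ Icc (0 : ℝ) 1) :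
    C u v ≤ u := by
  have h1 := (h.sub_mem_Icc_right hu v 1 hv.1 hv.2 le_rfl).1
  rw [h.margin_left u hu] at h1
  linarith

lemma measurable_deriv_left (h : IsCopulaOf C μ) :
    Measurable fun p : ℝ × ℝ => deriv (fun u => C u p.2) p.1 :=
  (measurable_deriv_with_param (f := fun v u => C u v)
    (h.continuous.comp continuous_swap)).comp measurable_swap

lemma measurable_deriv_right (h : IsCopulaOf C μ) :
    Measurable fun p : ℝ × ℝ => deriv (C p.1) p.2 :=
  measurable_deriv_with_param h.continuous

variable [IsProbabilityMeasure μ]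

lemma ae_mem (h : IsCopulaOf C μ) : ∀ᵐ p ∂μ, p ∈ Icc (0 : ℝ) 1 ×ˢ Icc (0 : ℝ) 1 := by
  have h1 : (1 : ℝ) ∈ Icc (0 : ℝ) 1 := by simp
  refine (prob_compl_eq_zero_iff (measurableSet_Icc.prod measurableSet_Icc)).2 ?_
  rw [h.measure_rect 1 h1 1 h1, h.margin_left 1 h1, ENNReal.ofReal_one]

/-- The first coordinate on the event `v ≤ s` has density `∂C/∂u (·, s)`. -/
lemma map_fst_restrict (h : IsCopulaOf C μ) {s : ℝ} (hs : s ∈ Icc (0 : ℝ) 1) :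
    (μ.restrict {p | p.2 ≤ s}).map Prod.fst = (volume.restrict (Icc 0 1)).withDensity
      fun u => ENNReal.ofReal (deriv (fun u => C u s) u) := by
  refine Measure.ext_of_Iic _ _ fun x => ?_
  have hset : (Prod.fst ⁻¹' Iic x ∩ {p : ℝ × ℝ | p.2 ≤ s} : Set (ℝ × ℝ)) =ᵐ[μ]
      (Icc 0 (min x 1) ×ˢ Icc 0 s : Set (ℝ × ℝ)) := by
    filter_upwards [h.ae_mem] with p hp
    apply propext
    simp only [mem_prod, mem_Icc] at hp
    change (p.1 ≤ x ∧ p.2 ≤ s) ↔ ((0 ≤ p.1 ∧ p.1 ≤ min x 1) ∧ 0 ≤ p.2 ∧ p.2 ≤ s)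
    rw [le_min_iff]
    tauto
  rw [Measure.map_apply measurable_fst measurableSet_Iic,
    Measure.restrict_apply (measurable_fst measurableSet_Iic), measure_congr hset,
    withDensity_apply _ measurableSet_Iic, Measure.restrict_restrict measurableSet_Iic,
    show Iic x ∩ Icc 0 1 = Icc 0 (min x 1) by
      ext; simp; tauto]
  rcases lt_or_ge x 0 with hx | hx
  · rw [Icc_eq_empty (by simp [hx])]
    simp
  · have hx' : min x 1 ∈ Icc (0 : ℝ) 1 := ⟨le_min hx zero_le_one, min_le_right _ _⟩
    rw [h.measure_rect _ hx' s hs, lintegral_deriv_eq_sub (h.sub_mem_Icc_left hs) le_rfl hx'.1 hx'.2,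
      h.zero_left hs, sub_zero]

lemma setLIntegral_fst (h : IsCopulaOf C μ) {s : ℝ} (hs : s ∈ Icc (0 : ℝ) 1) {g : ℝ → ℝ≥0∞}
    (hg : Measurable g) : ∫⁻ p in {p | p.2 ≤ s}, g p.1 ∂μ =
      ∫⁻ u in Icc 0 1, ENNReal.ofReal (deriv (fun u => C u s) u) * g u := by
  rw [← lintegral_map hg measurable_fst, h.map_fst_restrict hs,
    lintegral_withDensity_eq_lintegral_mul _ ?_ hg]
  · rfl
  · exact (measurable_deriv _).ennreal_ofReal

lemma lintegral_fst_sub (h : IsCopulaOf C μ) :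
    ∫⁻ p, ENNReal.ofReal (p.1 - C p.1 p.2) ∂μ = ∫⁻ s in Icc (0 : ℝ) 1, ∫⁻ u in Icc (0 : ℝ) 1,
      ENNReal.ofReal (deriv (fun u => C u s) u) * ENNReal.ofReal (deriv (C u) s) := by
  calc
    _ = ∫⁻ p : ℝ × ℝ, (∫⁻ s in Icc (0 : ℝ) 1,
        {q : (ℝ × ℝ) × ℝ | q.1.2 ≤ q.2}.indicator
          (fun q => ENNReal.ofReal (deriv (C q.1.1) q.2)) (p, s)) ∂μ := by
      refine lintegral_congr_ae ?_
      filter_upwards [h.ae_mem] with p hp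
      have heq := lintegral_deriv_eq_sub (h.sub_mem_Icc_right hp.1) hp.2.1 hp.2.2 le_rfl
      rw [h.margin_left _ hp.1] at heq
      rw [← heq, show Icc p.2 1 = Ici p.2 ∩ Icc 0 1 by
        ext t; simp only [mem_Icc, mem_inter_iff, mem_Ici]; have := hp.2.1; grind,
        ← Measure.restrict_restrict measurableSet_Ici, ← lintegral_indicator measurableSet_Ici]
      rfl
    _ = ∫⁻ s in Icc (0 : ℝ) 1, ∫⁻ p : ℝ × ℝ, {q : (ℝ × ℝ) × ℝ | q.1.2 ≤ q.2}.indicator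
          (fun q => ENNReal.ofReal (deriv (C q.1.1) q.2)) (p, s) ∂μ := by
      refine lintegral_lintegral_swap (Measurable.aemeasurable ?_)
      refine Measurable.indicator ?_
        (measurableSet_le (measurable_snd.comp measurable_fst) measurable_snd)
      exact (h.measurable_deriv_right.comp
        ((measurable_fst.comp measurable_fst).prodMk measurable_snd)).ennreal_ofReal
    _ = _ := by
      refine setLIntegral_congr_fun measurableSet_Icc fun s hs => ?_
      have hm : Measurable fun u => ENNReal.ofReal (deriv (C u) s) :=
        (h.measurable_deriv_right.comp (measurable_id.prodMk measurable_const)).ennreal_ofReal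
      rw [← h.setLIntegral_fst hs hm,
        ← lintegral_indicator (measurableSet_le measurable_snd measurable_const)]
      rfl

lemma integral_fst (h : IsCopulaOf C μ) : ∫ p, p.1 ∂μ = 1 / 2 := by
  have h1 : (1 : ℝ) ∈ Icc (0 : ℝ) 1 := by simp
  have hfull : μ.restrict {p | p.2 ≤ 1} = μ :=
    Measure.restrict_eq_self_of_ae_mem (h.ae_mem.mono fun p hp => hp.2.2)
  have hderiv : ∫⁻ u in Icc (0 : ℝ) 1,
      ENNReal.ofReal (deriv (fun u => C u 1) u) * ENNReal.ofReal u =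
      ∫⁻ u in Icc (0 : ℝ) 1, ENNReal.ofReal u := by
    rw [← restrict_Ioo_eq_restrict_Icc]
    refine setLIntegral_congr_fun measurableSet_Ioo fun u hu => ?_
    have hd : (fun u => C u 1) =ᶠ[𝓝 u] id := by
      filter_upwards [Icc_mem_nhds hu.1 hu.2] with x hx using h.margin_left x hx
    simp [hd.deriv_eq]
  have key := h.setLIntegral_fst h1 ENNReal.measurable_ofReal
  rw [hfull, hderiv] at key
  rw [integral_eq_lintegral_of_nonneg_ae (h.ae_mem.mono fun p hp => hp.1.1)
    measurable_fst.aestronglyMeasurable, key, ← integral_eq_lintegral_of_nonneg_ae (f := fun u : ℝ => u)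
    ((ae_restrict_mem (measurableSet_Icc (a := (0 : ℝ)) (b := 1))).mono fun u hu => hu.1)
    measurable_id.aestronglyMeasurable, integral_Icc_eq_integral_Ioc,
    ← intervalIntegral.integral_of_le zero_le_one, integral_id]
  norm_num

/-- Kendall's integral in terms of the partial derivatives of the copula. -/
lemma integral_eq (h : IsCopulaOf C μ) : ∫ p, C p.1 p.2 ∂μ =
    1 / 2 - (∫⁻ s in Icc (0 : ℝ) 1, ∫⁻ u in Icc (0 : ℝ) 1,
      ENNReal.ofReal (deriv (fun u => C u s) u) * ENNReal.ofReal (deriv (C u) s)).toReal := by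
  have hC : Measurable fun p : ℝ × ℝ => C p.1 p.2 := h.continuous.measurable
  have hfst : Integrable (fun p : ℝ × ℝ => p.1) μ := by
    refine Integrable.of_bound measurable_fst.aestronglyMeasurable 1 ?_
    filter_upwards [h.ae_mem] with p hp
    rw [Real.norm_of_nonneg hp.1.1]
    exact hp.1.2
  have hCint : Integrable (fun p : ℝ × ℝ => C p.1 p.2) μ := by
    refine Integrable.of_bound hC.aestronglyMeasurable 1 ?_
    filter_upwards [h.ae_mem] with p hp
    rw [Real.norm_of_nonneg (h.nonneg _ hp.1 _ hp.2)]
    exact (h.le_left hp.1 hp.2).trans hp.1.2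
  rw [← h.lintegral_fst_sub, ← integral_eq_lintegral_of_nonneg_ae, integral_sub hfst hCint,
    h.integral_fst]
  · ring
  · filter_upwards [h.ae_mem] with p hp
    exact sub_nonneg.2 (h.le_left hp.1 hp.2)
  · exact (measurable_fst.sub hC).aestronglyMeasurable

end IsCopulaOf

/-- The extension to the plane of the copula with parameters `a = 1 - p` and `b = 1 - q`. -/
def minPowCopula (p q u v : ℝ) : ℝ := min u (min v (u ^ p * v ^ q))

lemma continuous_minPowCopula {p q : ℝ} (hp : 0 ≤ p) (hq : 0 ≤ q) :
    Continuous (minPowCopula p q).uncurry := by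
  have h1 := (continuous_rpow_const hp).comp (continuous_fst (X := ℝ) (Y := ℝ))
  have h2 := (continuous_rpow_const hq).comp (continuous_snd (X := ℝ) (Y := ℝ))
  exact continuous_fst.min (continuous_snd.min (h1.mul h2))

lemma isCopulaOf_minPowCopula {p q : ℝ} (hp : p ∈ Icc (0 : ℝ) 1) (hq : q ∈ Icc (0 : ℝ) 1)
    {μ : Measure (ℝ × ℝ)} (hμ : ∀ u ∈ Icc (0 : ℝ) 1, ∀ v ∈ Icc (0 : ℝ) 1,
      μ (Icc 0 u ×ˢ Icc 0 v) = ENNReal.ofReal (minPowCopula p q u v)) :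
    IsCopulaOf (minPowCopula p q) μ where
  continuous := continuous_minPowCopula hp.1 hq.1
  nonneg u hu v hv := le_min hu.1 (le_min hv.1
    (mul_nonneg (rpow_nonneg hu.1 _) (rpow_nonneg hv.1 _)))
  margin_left u hu := by
    rw [minPowCopula, one_rpow, mul_one, min_eq_left]
    exact le_min hu.2 (self_le_rpow_of_le_one hu.1 hu.2 hp.2)
  margin_right v hv := by
    rw [minPowCopula, one_rpow, one_mul, min_eq_left (self_le_rpow_of_le_one hv.1 hv.2 hq.2),
      min_eq_right hv.2]
  measure_rect := hμ

section Derivatives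

variable {p q u v : ℝ}

lemma deriv_minPowCopula_right_eq_zero (h : ∀ᶠ y in 𝓝 v, u ≤ y ∧ u ≤ u ^ p * y ^ q) :
    deriv (minPowCopula p q u) v = 0 := by
  have heq : minPowCopula p q u =ᶠ[𝓝 v] fun _ => u := by
    filter_upwards [h] with y hy using min_eq_left (le_min hy.1 hy.2)
  simp [heq.deriv_eq]

lemma deriv_minPowCopula_left_eq_zero (h : ∀ᶠ x in 𝓝 u, v ≤ x ∧ v ≤ x ^ p * v ^ q) :
    deriv (fun x => minPowCopula p q x v) u = 0 := by
  have heq : (fun x => minPowCopula p q x v) =ᶠ[𝓝 u] fun _ => v := by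
    filter_upwards [h] with x hx
    rw [minPowCopula, min_eq_left hx.2, min_eq_right hx.1]
  simp [heq.deriv_eq]

lemma eventually_lt_rpow_mul_right (hv : 0 < v) {t : ℝ} (h : t < u ^ p * v ^ q) :
    ∀ᶠ y in 𝓝 v, t < u ^ p * y ^ q :=
  (continuousAt_const.mul (continuousAt_rpow_const v q (.inl hv.ne'))).eventually_const_lt h

lemma eventually_lt_rpow_mul_left (hu : 0 < u) {t : ℝ} (h : t < u ^ p * v ^ q) :
    ∀ᶠ x in 𝓝 u, t < x ^ p * v ^ q :=
  ((continuousAt_rpow_const u p (.inl hu.ne')).mul continuousAt_const).eventually_const_lt h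

lemma deriv_minPowCopula_right (hv : 0 < v) (h1 : u ^ p * v ^ q < u) (h2 : u ^ p * v ^ q < v) :
    deriv (minPowCopula p q u) v = u ^ p * (q * v ^ (q - 1)) := by
  have hc : ContinuousAt (fun y => u ^ p * y ^ q) v :=
    continuousAt_const.mul (continuousAt_rpow_const v q (.inl hv.ne'))
  have heq : minPowCopula p q u =ᶠ[𝓝 v] fun y => u ^ p * y ^ q := by
    filter_upwards [hc.eventually_lt_const h1, hc.eventually_lt continuousAt_id h2] with y hy1 hy2
    rw [minPowCopula, min_eq_right (show u ^ p * y ^ q ≤ y from hy2.le), min_eq_right hy1.le]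
  rw [heq.deriv_eq]
  exact ((hasDerivAt_rpow_const (.inl hv.ne')).const_mul _).deriv

lemma minPowCopula_comm (p q u v : ℝ) : minPowCopula p q u v = minPowCopula q p v u := by
  simp only [minPowCopula, mul_comm (u ^ p), min_left_comm u v]

lemma deriv_minPowCopula_left (hu : 0 < u) (h1 : u ^ p * v ^ q < u) (h2 : u ^ p * v ^ q < v) :
    deriv (fun x => minPowCopula p q x v) u = p * u ^ (p - 1) * v ^ q := by
  simp only [fun x => minPowCopula_comm p q x v]
  rw [mul_comm] at h1 h2
  rw [deriv_minPowCopula_right hu h2 h1, mul_comm]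

end Derivatives

lemma lintegral_deriv_mul_deriv_of_add_eq_one {p q : ℝ} (hp : 0 ≤ p) (hq : 0 ≤ q)
    (hpq : p + q = 1) {v : ℝ} (hv : v ∈ Ioo (0 : ℝ) 1) :
    ∫⁻ u in Icc (0 : ℝ) 1, ENNReal.ofReal (deriv (fun u => minPowCopula p q u v) u) *
      ENNReal.ofReal (deriv (minPowCopula p q u) v) = 0 := by
  have hself : ∀ x : ℝ, 0 < x → x ^ p * x ^ q = x := fun x hx => by
    rw [← rpow_add hx, hpq, rpow_one]
  refine (lintegral_congr_ae ?_).trans lintegral_zero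
  rw [← restrict_Ioo_eq_restrict_Icc]
  filter_upwards [ae_restrict_mem measurableSet_Ioo, Measure.ae_ne _ v] with u hu huv
  rcases lt_or_gt_of_ne huv with h | h
  · rw [deriv_minPowCopula_right_eq_zero, ENNReal.ofReal_zero, mul_zero]
    filter_upwards [lt_mem_nhds h] with y hy
    have := mul_le_mul_of_nonneg_left (rpow_le_rpow hu.1.le hy.le hq) (rpow_nonneg hu.1.le p)
    exact ⟨hy.le, by linarith [hself u hu.1]⟩
  · rw [deriv_minPowCopula_left_eq_zero, ENNReal.ofReal_zero, zero_mul]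
    filter_upwards [lt_mem_nhds h] with x hx
    have := mul_le_mul_of_nonneg_right (rpow_le_rpow hv.1.le hx.le hp) (rpow_nonneg hv.1.le q)
    exact ⟨hx.le, by linarith [hself v hv.1]⟩

/-- The mass of the product of the partial derivatives on a horizontal section; the product is
supported on the interval `(l, r)` on which the power function is the smallest of the three. -/
lemma lintegral_deriv_mul_deriv {a b : ℝ} (ha : 0 ≤ a) (hab : a + b < 1)
    (hb : 0 ≤ b) {v l r : ℝ} (hv : v ∈ Ioo (0 : ℝ) 1) (hl : 0 ≤ l) (hlr : l ≤ r) (hr : r ≤ 1)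
    (hl_lt : ∀ u ∈ Ioo (0 : ℝ) 1, l < u → v ^ (1 - b) < u ^ a)
    (hlt_l : ∀ u ∈ Ioo (0 : ℝ) 1, u < l → u ^ a < v ^ (1 - b))
    (hr_lt : ∀ u ∈ Ioo (0 : ℝ) 1, r < u → v ^ b < u ^ (1 - a))
    (hlt_r : ∀ u ∈ Ioo (0 : ℝ) 1, u < r → u ^ (1 - a) < v ^ b) :
    ∫⁻ u in Icc (0 : ℝ) 1, ENNReal.ofReal (deriv (fun u => minPowCopula (1 - a) (1 - b) u v) u) *
      ENNReal.ofReal (deriv (minPowCopula (1 - a) (1 - b) u) v) =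
    ENNReal.ofReal ((1 - b) / 2 * v ^ (1 - 2 * b) * (r ^ (2 * (1 - a)) - l ^ (2 * (1 - a)))) := by
  have hsplit : ∀ x c : ℝ, 0 < x → x ^ (1 - c) * x ^ c = x := fun x c hx => by
    rw [← rpow_add hx, sub_add_cancel, rpow_one]
  set f : ℝ → ℝ := fun u => (1 - a) * (1 - b) * v ^ (1 - 2 * b) * u ^ (1 - 2 * a) with hf
  have hconst : 0 ≤ (1 - a) * (1 - b) * v ^ (1 - 2 * b) :=
    mul_nonneg (mul_nonneg (by linarith) (by linarith)) (rpow_nonneg hv.1.le _)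
  have hae : ∀ᵐ u ∂volume.restrict (Icc (0 : ℝ) 1),
      ENNReal.ofReal (deriv (fun u => minPowCopula (1 - a) (1 - b) u v) u) *
        ENNReal.ofReal (deriv (minPowCopula (1 - a) (1 - b) u) v) =
      (Ioo l r).indicator (fun u => ENNReal.ofReal (f u)) u := by
    rw [← restrict_Ioo_eq_restrict_Icc]
    filter_upwards [ae_restrict_mem measurableSet_Ioo, Measure.ae_ne _ l, Measure.ae_ne _ r]
      with u hu hul hur
    have hpu := rpow_pos_of_pos hu.1 (1 - a)
    have hpv := rpow_pos_of_pos hv.1 (1 - b)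
    have hu' := hsplit u a hu.1
    have hv' := hsplit v b hv.1
    by_cases hmem : u ∈ Ioo l r
    · have h1 : u ^ (1 - a) * v ^ (1 - b) < u := by
        have := mul_lt_mul_of_pos_left (hl_lt u hu hmem.1) hpu
        linarith
      have h2 : u ^ (1 - a) * v ^ (1 - b) < v := by
        have := mul_lt_mul_of_pos_right (hlt_r u hu hmem.2) hpv
        linarith
      rw [indicator_of_mem hmem, deriv_minPowCopula_left hu.1 h1 h2,
        deriv_minPowCopula_right hv.1 h1 h2, ← ENNReal.ofReal_mul]
      · congr 1
        have e1 : u ^ (1 - a - 1) * u ^ (1 - a) = u ^ (1 - 2 * a) := by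
          rw [← rpow_add hu.1]; ring_nf
        have e2 : v ^ (1 - b) * v ^ (1 - b - 1) = v ^ (1 - 2 * b) := by
          rw [← rpow_add hv.1]; ring_nf
        simp only [hf, ← e1, ← e2]
        ring
      · exact mul_nonneg (mul_nonneg (by linarith) (rpow_nonneg hu.1.le _)) hpv.le
    · rw [indicator_of_notMem hmem]
      rcases lt_or_gt_of_ne hul with h | h
      · have h1 : u < u ^ (1 - a) * v ^ (1 - b) := by
          have := mul_lt_mul_of_pos_left (hlt_l u hu h) hpu
          linarith
        have h2 : u ^ (1 - a) * v ^ (1 - b) < v := by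
          have := mul_lt_mul_of_pos_right (hlt_r u hu (h.trans_le hlr)) hpv
          linarith
        rw [deriv_minPowCopula_right_eq_zero, ENNReal.ofReal_zero, mul_zero]
        filter_upwards [lt_mem_nhds (h1.trans h2), eventually_lt_rpow_mul_right hv.1 h1]
          with y hy1 hy2 using ⟨hy1.le, hy2.le⟩
      · have h' : r < u := lt_of_le_of_ne (not_lt.1 fun h' => hmem ⟨h, h'⟩) hur.symm
        have h1 : v < u ^ (1 - a) * v ^ (1 - b) := by
          have := mul_lt_mul_of_pos_right (hr_lt u hu h') hpv
          linarith
        have h2 : u ^ (1 - a) * v ^ (1 - b) < u := by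
          have := mul_lt_mul_of_pos_left (hl_lt u hu h) hpu
          linarith
        rw [deriv_minPowCopula_left_eq_zero, ENNReal.ofReal_zero, zero_mul]
        filter_upwards [lt_mem_nhds (h1.trans h2), eventually_lt_rpow_mul_left hu.1 h1]
          with x hx1 hx2 using ⟨hx1.le, hx2.le⟩
  have hexp : -1 < 1 - 2 * a := by linarith
  have hint : IntervalIntegrable f volume l r :=
    (intervalIntegral.intervalIntegrable_rpow' hexp).const_mul _
  rw [intervalIntegrable_iff_integrableOn_Ioo_of_le hlr] at hint
  rw [lintegral_congr_ae hae, lintegral_indicator measurableSet_Ioo,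
    Measure.restrict_restrict measurableSet_Ioo, inter_eq_left.2
      (Ioo_subset_Icc_self.trans (Icc_subset_Icc hl hr)), ← ofReal_integral_eq_lintegral_ofReal hint,
    ← integral_Ioc_eq_integral_Ioo, ← intervalIntegral.integral_of_le hlr,
    intervalIntegral.integral_const_mul, integral_rpow (.inl hexp)]
  · rw [show 1 - 2 * a + 1 = 2 * (1 - a) by ring]
    congr 1
    have : 1 - a ≠ 0 := by linarith
    field_simp
  · filter_upwards [ae_restrict_mem measurableSet_Ioo] with u hu
    exact mul_nonneg hconst (rpow_nonneg (hl.trans hu.1.le) _)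

lemma lintegral_mul_self_sub_rpow {c k : ℝ} (hc : 0 ≤ c) (hk : 1 ≤ k) :
    ∫⁻ v in Icc (0 : ℝ) 1, ENNReal.ofReal (c * (v - v ^ k)) =
      ENNReal.ofReal (c * (1 / 2 - 1 / (k + 1))) := by
  have hint : IntervalIntegrable (fun v : ℝ => c * (v - v ^ k)) volume 0 1 :=
    (intervalIntegral.intervalIntegrable_id.sub
      (intervalIntegral.intervalIntegrable_rpow' (by linarith))).const_mul c
  rw [intervalIntegrable_iff_integrableOn_Icc_of_le zero_le_one] at hint
  rw [← ofReal_integral_eq_lintegral_ofReal hint, integral_Icc_eq_integral_Ioc,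
    ← intervalIntegral.integral_of_le zero_le_one, intervalIntegral.integral_const_mul,
    intervalIntegral.integral_sub intervalIntegral.intervalIntegrable_id
      (intervalIntegral.intervalIntegrable_rpow' (by linarith)), integral_id,
    integral_rpow (.inl (by linarith)), one_rpow, zero_rpow (by linarith)]
  · norm_num
  · filter_upwards [ae_restrict_mem measurableSet_Icc] with v hv
    refine mul_nonneg hc (sub_nonneg.2 ?_)
    simpa using rpow_le_rpow_of_exponent_ge' hv.1 hv.2 zero_le_one hk

lemma lintegral_lintegral_deriv_mul_deriv {a b : ℝ} (ha : 0 ≤ a) (hb : 0 ≤ b) (hab : a + b ≤ 1) :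
    ∫⁻ v in Icc (0 : ℝ) 1, ∫⁻ u in Icc (0 : ℝ) 1,
      ENNReal.ofReal (deriv (fun u => minPowCopula (1 - a) (1 - b) u v) u) *
        ENNReal.ofReal (deriv (minPowCopula (1 - a) (1 - b) u) v) =
      ENNReal.ofReal ((1 - (a + b)) / 4) := by
  refine (setLIntegral_congr Ioo_ae_eq_Icc).symm.trans ?_
  rcases hab.eq_or_lt with hab | hab
  · rw [setLIntegral_congr_fun measurableSet_Ioo fun v hv =>
      lintegral_deriv_mul_deriv_of_add_eq_one (p := 1 - a) (q := 1 - b)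
        (by linarith) (by linarith) (by linarith) hv]
    simp [hab]
  have hp : 0 < 1 - a := by linarith
  have hq : 0 < 1 - b := by linarith
  have hr : ∀ v ∈ Ioo (0 : ℝ) 1, (v ^ b) ^ (1 - a)⁻¹ ≤ 1 := fun v hv =>
    rpow_le_one (rpow_nonneg hv.1.le _) (rpow_le_one hv.1.le hv.2.le hb) (inv_nonneg.2 hp.le)
  have hr_lt : ∀ v ∈ Ioo (0 : ℝ) 1, ∀ u ∈ Ioo (0 : ℝ) 1,
      (v ^ b) ^ (1 - a)⁻¹ < u → v ^ b < u ^ (1 - a) := fun v hv u hu =>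
    (rpow_inv_lt_iff_of_pos (rpow_nonneg hv.1.le _) hu.1.le hp).1
  have hlt_r : ∀ v ∈ Ioo (0 : ℝ) 1, ∀ u ∈ Ioo (0 : ℝ) 1,
      u < (v ^ b) ^ (1 - a)⁻¹ → u ^ (1 - a) < v ^ b := fun v hv u hu =>
    (lt_rpow_inv_iff_of_pos hu.1.le (rpow_nonneg hv.1.le _) hp).1
  have hr_eq : ∀ v ∈ Ioo (0 : ℝ) 1,
      v ^ (1 - 2 * b) * ((v ^ b) ^ (1 - a)⁻¹) ^ (2 * (1 - a)) = v := fun v hv => by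
    rw [← rpow_mul hv.1.le, ← rpow_mul hv.1.le, ← rpow_add hv.1]
    rw [show 1 - 2 * b + b * (1 - a)⁻¹ * (2 * (1 - a)) = 1 by field_simp; ring, rpow_one]
  rcases ha.eq_or_lt with rfl | ha
  · have hsection : ∀ v ∈ Ioo (0 : ℝ) 1, ∫⁻ u in Icc (0 : ℝ) 1,
        ENNReal.ofReal (deriv (fun u => minPowCopula (1 - 0) (1 - b) u v) u) *
          ENNReal.ofReal (deriv (minPowCopula (1 - 0) (1 - b) u) v) =
        ENNReal.ofReal ((1 - b) / 2 * v) := fun v hv => by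
      rw [lintegral_deriv_mul_deriv le_rfl hab hb hv le_rfl
        (rpow_nonneg (rpow_nonneg hv.1.le _) _) (hr v hv)
        (fun u hu _ => by rw [rpow_zero]; exact rpow_lt_one hv.1.le hv.2 hq)
        (fun u hu h => absurd hu.1 h.not_gt) (hr_lt v hv) (hlt_r v hv),
        zero_rpow (by norm_num), sub_zero, mul_assoc, hr_eq v hv]
    rw [setLIntegral_congr_fun measurableSet_Ioo hsection, restrict_Ioo_eq_restrict_Icc]
    have hint : IntervalIntegrable (fun v : ℝ => (1 - b) / 2 * v) volume 0 1 :=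
      intervalIntegral.intervalIntegrable_id.const_mul _
    rw [intervalIntegrable_iff_integrableOn_Icc_of_le zero_le_one] at hint
    rw [← ofReal_integral_eq_lintegral_ofReal hint, integral_Icc_eq_integral_Ioc,
      ← intervalIntegral.integral_of_le zero_le_one, intervalIntegral.integral_const_mul,
      integral_id]
    · congr 1; ring
    · filter_upwards [ae_restrict_mem measurableSet_Icc] with v hv
      exact mul_nonneg (by linarith) hv.1
  · have hk : 1 ≤ 2 * (1 - b) / a - 1 := by
      rw [le_sub_iff_add_le, le_div_iff₀ ha]
      linarith
    have hsection : ∀ v ∈ Ioo (0 : ℝ) 1, ∫⁻ u in Icc (0 : ℝ) 1,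
        ENNReal.ofReal (deriv (fun u => minPowCopula (1 - a) (1 - b) u v) u) *
          ENNReal.ofReal (deriv (minPowCopula (1 - a) (1 - b) u) v) =
        ENNReal.ofReal ((1 - b) / 2 * (v - v ^ (2 * (1 - b) / a - 1))) := fun v hv => by
      have hlr : (v ^ (1 - b)) ^ a⁻¹ ≤ (v ^ b) ^ (1 - a)⁻¹ := by
        rw [← rpow_mul hv.1.le, ← rpow_mul hv.1.le]
        refine rpow_le_rpow_of_exponent_ge hv.1 hv.2.le ?_
        rw [← div_eq_mul_inv, ← div_eq_mul_inv, div_le_div_iff₀ hp ha]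
        nlinarith
      have hl_eq : v ^ (1 - 2 * b) * ((v ^ (1 - b)) ^ a⁻¹) ^ (2 * (1 - a)) =
          v ^ (2 * (1 - b) / a - 1) := by
        rw [← rpow_mul hv.1.le, ← rpow_mul hv.1.le, ← rpow_add hv.1]
        congr 1
        field_simp
        ring
      rw [lintegral_deriv_mul_deriv ha.le hab hb hv (rpow_nonneg (rpow_nonneg hv.1.le _) _)
        hlr (hr v hv)
        (fun u hu => (rpow_inv_lt_iff_of_pos (rpow_nonneg hv.1.le _) hu.1.le ha).1)
        (fun u hu => (lt_rpow_inv_iff_of_pos hu.1.le (rpow_nonneg hv.1.le _) ha).1)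
        (hr_lt v hv) (hlt_r v hv), mul_assoc, mul_sub (v ^ (1 - 2 * b)), hr_eq v hv, hl_eq]
    rw [setLIntegral_congr_fun measurableSet_Ioo hsection, restrict_Ioo_eq_restrict_Icc,
      lintegral_mul_self_sub_rpow (by linarith) hk]
    congr 1
    field_simp
    ring

theorem stmt_6 (lam a b : ℝ) (ha : 0 ≤ a) (hb : 0 ≤ b) (hab : a + b = lam)
    (hlam : lam ≤ 1) (C : ℝ → ℝ → ℝ)
    (hCdef : ∀ u v : ℝ, u ∈ Set.Icc (0:ℝ) 1 → v ∈ Set.Icc (0:ℝ) 1 →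
      C u v = min u (min v (u ^ (1 - a) * v ^ (1 - b))))
    (μ : Measure (ℝ × ℝ)) [IsProbabilityMeasure μ]
    (hμ : ∀ u v : ℝ, u ∈ Set.Icc (0:ℝ) 1 → v ∈ Set.Icc (0:ℝ) 1 →
      μ (Set.Icc 0 u ×ˢ Set.Icc 0 v) = ENNReal.ofReal (C u v)) :
    4 * (∫ p : ℝ × ℝ, C p.1 p.2 ∂μ) - 1 = lam := by
  have h : IsCopulaOf (minPowCopula (1 - a) (1 - b)) μ :=
    isCopulaOf_minPowCopula ⟨by linarith, by linarith⟩ ⟨by linarith, by linarith⟩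
      fun u hu v hv => (hμ u v hu hv).trans (congrArg _ (hCdef u v hu hv))
  have hint : ∫ p, C p.1 p.2 ∂μ = ∫ p, minPowCopula (1 - a) (1 - b) p.1 p.2 ∂μ :=
    integral_congr_ae (h.ae_mem.mono fun p hp => hCdef _ _ hp.1 hp.2)
  rw [hint, h.integral_eq, lintegral_lintegral_deriv_mul_deriv ha hb (hab.trans_le hlam),
    ENNReal.toReal_ofReal (by linarith)]
  linarith
end
end

section
/- Let C be a bivariate extreme value copula with upper tail dependence coefficient λ ∈ [0,1], and let μ be the probability measure on [0,1]² with μ([0,u]×[0,v]) = C(u,v) for all u, v ∈ [0,1]. Then Kendall's coefficient τ = 4∫ C dμ − 1 satisfies τ ≥ λ/(2 − λ). -/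
open MeasureTheory Filter Set Real

noncomputable section

/-- A bivariate copula: boundary conditions and the 2-increasing property. -/
def IsCopula (C : ℝ → ℝ → ℝ) : Prop :=
  (∀ u : ℝ, 0 ≤ u → u ≤ 1 → C u 0 = 0 ∧ C 0 u = 0 ∧ C u 1 = u ∧ C 1 u = u) ∧
  (∀ u₁ u₂ v₁ v₂ : ℝ, 0 ≤ u₁ → u₁ ≤ u₂ → u₂ ≤ 1 → 0 ≤ v₁ → v₁ ≤ v₂ → v₂ ≤ 1 →
    0 ≤ C u₂ v₂ - C u₂ v₁ - C u₁ v₂ + C u₁ v₁)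

/-- An extreme value copula: a copula satisfying the max-stability identity. -/
def IsExtremeValueCopula (C : ℝ → ℝ → ℝ) : Prop :=
  IsCopula C ∧ ∀ s : ℝ, 0 < s → ∀ u v : ℝ, 0 ≤ u → u ≤ 1 → 0 ≤ v → v ≤ 1 →
    C (u ^ s) (v ^ s) = C u v ^ s

/-- `C` has upper tail dependence coefficient `lam`,
i.e. `lam = 2 - lim_{t → 1⁻} (1 - C t t)/(1 - t)`. -/
def HasUpperTailDep (C : ℝ → ℝ → ℝ) (lam : ℝ) : Prop :=
  Tendsto (fun t : ℝ => (1 - C t t) / (1 - t)) (nhdsWithin 1 (Set.Iio 1))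
    (nhds (2 - lam))

theorem integral_sub_eq_intervalIntegral_measureReal_le {Ω : Type*} [MeasurableSpace Ω]
    (ν : Measure Ω) [IsFiniteMeasure ν] {Y : Ω → ℝ} (hY : Measurable Y) {T : ℝ}
    (hT : 0 ≤ T) (h0 : ∀ᵐ ω ∂ν, 0 ≤ Y ω) (h1 : ∀ᵐ ω ∂ν, Y ω ≤ T) :
    ∫ ω, (T - Y ω) ∂ν = ∫ s in (0:ℝ)..T, ν.real {ω | Y ω ≤ s} := by
  have hint : Integrable (fun ω => T - Y ω) ν := by
    refine Integrable.of_bound (hY.const_sub T).aestronglyMeasurable T ?_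
    filter_upwards [h0, h1] with ω h h'
    rw [Real.norm_eq_abs, abs_le]; constructor <;> linarith
  rw [hint.integral_eq_integral_Ioc_meas_le (M := T)
    (by filter_upwards [h1] with ω h using sub_nonneg.2 h)
    (by filter_upwards [h0] with ω h using by linarith),
    ← intervalIntegral.integral_of_le hT]
  have := intervalIntegral.integral_comp_sub_left (a := 0) (b := T)
    (fun s => ν.real {ω | Y ω ≤ s}) T
  rw [sub_self, sub_zero] at this
  rw [← this]
  refine intervalIntegral.integral_congr fun s _ => ?_
  simp only [le_sub_comm]

theorem monotone_measureReal_le {Ω : Type*} [MeasurableSpace Ω]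
    (ν : Measure Ω) [IsFiniteMeasure ν] (Y : Ω → ℝ) :
    Monotone fun s : ℝ => ν.real {ω | Y ω ≤ s} :=
  fun _ _ h => measureReal_mono fun _ hω => le_trans hω h

theorem integral_eq_half_of_uniform {Ω : Type*} [MeasurableSpace Ω]
    (ν : Measure Ω) [IsProbabilityMeasure ν] {Y : Ω → ℝ} (hY : Measurable Y)
    (h0 : ∀ᵐ ω ∂ν, 0 ≤ Y ω) (h1 : ∀ᵐ ω ∂ν, Y ω ≤ 1)
    (h : ∀ s ∈ Icc (0:ℝ) 1, ν.real {ω | Y ω ≤ s} = s) :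
    ∫ ω, Y ω ∂ν = 1 / 2 := by
  have key := integral_sub_eq_intervalIntegral_measureReal_le ν hY zero_le_one h0 h1
  have hint : Integrable Y ν := by
    refine Integrable.of_bound hY.aestronglyMeasurable 1 ?_
    filter_upwards [h0, h1] with ω h h'
    rwa [Real.norm_eq_abs, abs_of_nonneg h]
  rw [integral_sub (integrable_const _) hint, integral_const] at key
  have : ∫ s in (0:ℝ)..1, ν.real {ω | Y ω ≤ s} = ∫ s in (0:ℝ)..1, s :=
    intervalIntegral.integral_congr fun s hs => h s (by rwa [uIcc_of_le zero_le_one] at hs)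
  rw [this, integral_id] at key
  simp at key
  linarith

/-- If `0 ≤ X ≤ M` and the joint law of `(X, M)` dominates `u * t ^ a`, then the mean of `X`
over `{M ≤ t}` is at most half the maximal value `t`. -/
theorem setIntegral_le_of_joint_law {Ω : Type*} [MeasurableSpace Ω]
    (μ : Measure Ω) [IsProbabilityMeasure μ] {X M : Ω → ℝ} (hX : Measurable X)
    (hM : Measurable M) (h0 : ∀ᵐ ω ∂μ, 0 ≤ X ω) (hXM : ∀ᵐ ω ∂μ, X ω ≤ M ω)
    {a t : ℝ} (ht : t ∈ Icc (0:ℝ) 1)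
    (hMlaw : μ.real {ω | M ω ≤ t} = t * t ^ a)
    (hjoint : ∀ u ∈ Icc (0:ℝ) t, u * t ^ a ≤ μ.real {ω | X ω ≤ u ∧ M ω ≤ t}) :
    ∫ ω in {ω | M ω ≤ t}, X ω ∂μ ≤ t ^ 2 * t ^ a / 2 := by
  have hS : MeasurableSet {ω | M ω ≤ t} := measurableSet_le hM measurable_const
  have h0' := ae_restrict_of_ae (s := {ω | M ω ≤ t}) h0
  have h1' : ∀ᵐ ω ∂μ.restrict {ω | M ω ≤ t}, X ω ≤ t := by
    filter_upwards [ae_restrict_of_ae hXM, ae_restrict_mem hS] with ω h h'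
    exact le_trans h h'
  have key := integral_sub_eq_intervalIntegral_measureReal_le (μ.restrict {ω | M ω ≤ t}) hX
    ht.1 h0' h1'
  have hint : Integrable X (μ.restrict {ω | M ω ≤ t}) := by
    refine Integrable.of_bound hX.aestronglyMeasurable t ?_
    filter_upwards [h0', h1'] with ω h h'
    rwa [Real.norm_eq_abs, abs_of_nonneg h]
  rw [integral_sub (integrable_const _) hint, integral_const, measureReal_restrict_apply_univ,
    hMlaw, smul_eq_mul] at key
  have : ∫ s in (0:ℝ)..t, s * t ^ a ≤
      ∫ s in (0:ℝ)..t, (μ.restrict {ω | M ω ≤ t}).real {ω | X ω ≤ s} := by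
    refine intervalIntegral.integral_mono_on ht.1
      ((continuous_id.mul continuous_const).intervalIntegrable _ _)
      (monotone_measureReal_le _ X).intervalIntegrable fun s hs => ?_
    rw [measureReal_restrict_apply (measurableSet_le hX measurable_const)]
    exact hjoint s hs
  rw [intervalIntegral.integral_mul_const, integral_id] at this
  nlinarith

theorem le_integral_mul_rpow_of_joint_law {Ω : Type*} [MeasurableSpace Ω]
    (μ : Measure Ω) [IsProbabilityMeasure μ] {X M : Ω → ℝ} (hX : Measurable X)
    (hM : Measurable M) (h0 : ∀ᵐ ω ∂μ, 0 ≤ X ω) (hXM : ∀ᵐ ω ∂μ, X ω ≤ M ω)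
    (hM1 : ∀ᵐ ω ∂μ, M ω ≤ 1) {a : ℝ} (ha : 0 ≤ a)
    (hmean : ∫ ω, X ω ∂μ = 1 / 2)
    (hMlaw : ∀ t ∈ Icc (0:ℝ) 1, μ.real {ω | M ω ≤ t} = t * t ^ a)
    (hjoint : ∀ t ∈ Icc (0:ℝ) 1, ∀ u ∈ Icc (0:ℝ) t,
      u * t ^ a ≤ μ.real {ω | X ω ≤ u ∧ M ω ≤ t}) :
    1 / 2 - a / (4 * (1 + a)) ≤ ∫ ω, X ω * M ω ^ a ∂μ := by
  rcases ha.eq_or_lt with rfl | ha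
  · simp [hmean]
  have hdens : Measurable fun ω => ENNReal.ofReal (X ω) := hX.ennreal_ofReal
  have hXint : Integrable X μ := by
    refine Integrable.of_bound hX.aestronglyMeasurable 1 ?_
    filter_upwards [h0, hXM, hM1] with ω h h' h''
    rw [Real.norm_eq_abs, abs_of_nonneg h]; linarith
  set ν := μ.withDensity fun ω => ENNReal.ofReal (X ω) with hν
  have : IsFiniteMeasure ν := isFiniteMeasure_withDensity_ofReal hXint.2
  have hac : ν ≪ μ := withDensity_absolutelyContinuous _ _
  have hMa : Measurable fun ω => M ω ^ a := hM.pow_const a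
  have hM0 : ∀ᵐ ω ∂μ, 0 ≤ M ω := by filter_upwards [h0, hXM] with ω h h' using h.trans h'
  have key := integral_sub_eq_intervalIntegral_measureReal_le ν hMa zero_le_one
    (by filter_upwards [hac.ae_le hM0] with ω h using rpow_nonneg h a)
    (by filter_upwards [hac.ae_le hM0, hac.ae_le hM1] with ω h h' using rpow_le_one h h' ha.le)
  have hlhs : ∫ ω, (1 - M ω ^ a) ∂ν = 1 / 2 - ∫ ω, X ω * M ω ^ a ∂μ := by
    rw [hν, integral_withDensity_eq_integral_toReal_smul hdens (by simp), ← hmean,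
      ← integral_sub hXint]
    · refine integral_congr_ae ?_
      filter_upwards [h0] with ω h
      rw [ENNReal.toReal_ofReal h, smul_eq_mul]; ring
    · refine Integrable.of_bound (hX.mul hMa).aestronglyMeasurable 1 ?_
      filter_upwards [h0, hXM, hM1] with ω h h' h''
      have := rpow_nonneg (h.trans h') a
      rw [Real.norm_eq_abs, abs_of_nonneg (by positivity)]
      exact mul_le_one₀ (h'.trans h'') this (rpow_le_one (h.trans h') h'' ha.le)
  have hbound : ∫ s in (0:ℝ)..1, ν.real {ω | M ω ^ a ≤ s} ≤
      ∫ s in (0:ℝ)..1, s ^ (2 / a + 1) / 2 := by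
    refine intervalIntegral.integral_mono_on zero_le_one
      (monotone_measureReal_le ν _).intervalIntegrable
      ((continuous_id.rpow_const fun _ => Or.inr (by positivity)).div_const 2
        |>.intervalIntegrable _ _) fun s hs => ?_
    have hs' : s ^ a⁻¹ ∈ Icc (0:ℝ) 1 :=
      ⟨rpow_nonneg hs.1 _, rpow_le_one hs.1 hs.2 (by positivity)⟩
    have hset : ν.real {ω | M ω ^ a ≤ s} = ν.real {ω | M ω ≤ s ^ a⁻¹} := by
      refine measureReal_congr ?_
      filter_upwards [hac.ae_le hM0] with ω h
      exact propext (Real.le_rpow_inv_iff_of_pos h hs.1 ha).symm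
    have hval : ν.real {ω | M ω ≤ s ^ a⁻¹} = ∫ ω in {ω | M ω ≤ s ^ a⁻¹}, X ω ∂μ := by
      rw [measureReal_def, hν, withDensity_apply _ (measurableSet_le hM measurable_const),
        integral_eq_lintegral_of_nonneg_ae (ae_restrict_of_ae h0) hX.aestronglyMeasurable]
    rw [hset, hval]
    refine (setIntegral_le_of_joint_law μ hX hM h0 hXM hs' (hMlaw _ hs') (hjoint _ hs')).trans ?_
    have : (s ^ a⁻¹) ^ 2 * (s ^ a⁻¹) ^ a = s ^ (2 / a + 1) := by
      rw [← rpow_mul hs.1, inv_mul_cancel₀ ha.ne', ← rpow_natCast, ← rpow_mul hs.1,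
        rpow_add_of_nonneg hs.1 (by positivity) zero_le_one]
      congr 2
      push_cast; ring
    rw [this]
  rw [intervalIntegral.integral_div, integral_rpow (Or.inl (by have : 0 < 2 / a := by positivity
                                                               linarith))] at hbound
  rw [one_rpow, zero_rpow (by positivity)] at hbound
  have hc : (1 - 0) / (2 / a + 1 + 1) / 2 = a / (4 * (1 + a)) := by field_simp; ring
  rw [hc] at hbound
  linarith

theorem tendsto_rpow_sub_one_div {x : ℝ} (hx : 0 < x) :
    Tendsto (fun s : ℝ => (x ^ s - 1) / s) (nhdsWithin 0 (Ioi 0)) (nhds (log x)) := by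
  have h : HasDerivAt (fun s : ℝ => x ^ s) (log x) 0 := by
    simpa using (hasDerivAt_id (0:ℝ)).const_rpow hx
  have := (hasDerivAt_iff_tendsto_slope.1 h).mono_left
    (nhdsWithin_mono 0 fun y (hy : 0 < y) => hy.ne')
  refine this.congr fun s => ?_
  simp [slope_def_field]

theorem IsCopula.le_add_sub {C : ℝ → ℝ → ℝ} (hC : IsCopula C) {u u' v : ℝ} (hu : 0 ≤ u)
    (huu : u ≤ u') (hu' : u' ≤ 1) (hv : 0 ≤ v) (hv' : v ≤ 1) :
    C u' v ≤ C u v + (u' - u) := by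
  have := hC.2 u u' v 1 hu huu hu' hv hv' le_rfl
  rw [(hC.1 u hu (huu.trans hu')).2.2.1, (hC.1 u' (hu.trans huu) hu').2.2.1] at this
  linarith

theorem IsCopula.nonneg {C : ℝ → ℝ → ℝ} (hC : IsCopula C) {u v : ℝ} (hu : 0 ≤ u)
    (hu' : u ≤ 1) (hv : 0 ≤ v) (hv' : v ≤ 1) : 0 ≤ C u v := by
  have := hC.2 0 u 0 v le_rfl hu hu' le_rfl hv hv'
  rw [(hC.1 u hu hu').1, (hC.1 v hv hv').2.1, (hC.1 0 le_rfl zero_le_one).1] at this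
  linarith

theorem IsCopula.swap {C : ℝ → ℝ → ℝ} (hC : IsCopula C) : IsCopula fun u v => C v u := by
  refine ⟨fun u hu hu' => ?_, fun u₁ u₂ v₁ v₂ a b c d e f => ?_⟩
  · obtain ⟨h1, h2, h3, h4⟩ := hC.1 u hu hu'
    exact ⟨h2, h1, h4, h3⟩
  · have := hC.2 v₁ v₂ u₁ u₂ d e f a b c
    dsimp only
    linarith

theorem IsExtremeValueCopula.swap {C : ℝ → ℝ → ℝ} (hC : IsExtremeValueCopula C) :
    IsExtremeValueCopula fun u v => C v u :=
  ⟨hC.1.swap, fun s hs u v hu hu' hv hv' => hC.2 s hs v u hv hv' hu hu'⟩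

theorem IsExtremeValueCopula.pos {C : ℝ → ℝ → ℝ} (hC : IsExtremeValueCopula C) {u v : ℝ}
    (hu : 0 < u) (hu' : u ≤ 1) (hv : 0 < v) (hv' : v ≤ 1) : 0 < C u v := by
  have hlim : Tendsto (fun s : ℝ => u ^ s + v ^ s - 1) (nhdsWithin 0 (Ioi 0)) (nhds 1) := by
    have : ContinuousAt (fun s : ℝ => u ^ s + v ^ s - 1) 0 :=
      (((continuous_const_rpow hu.ne').add (continuous_const_rpow hv.ne')).sub
        continuous_const).continuousAt
    have := this.tendsto.mono_left (nhdsWithin_le_nhds (s := Ioi 0))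
    simpa using this
  obtain ⟨s, hs, hs0⟩ :=
    ((hlim.eventually (lt_mem_nhds zero_lt_one)).and self_mem_nhdsWithin).exists
  have hs0 : 0 < s := hs0
  refine (hC.1.nonneg hu.le hu' hv.le hv').lt_of_ne fun h => ?_
  have hvs : v ^ s ≤ 1 := rpow_le_one hv.le hv' hs0.le
  have h1 := hC.1.le_add_sub (rpow_nonneg hu.le s) (rpow_le_one hu.le hu' hs0.le) le_rfl
    (rpow_nonneg hv.le s) hvs
  rw [(hC.1.1 _ (rpow_nonneg hv.le s) hvs).2.2.2, hC.2 s hs0 u v hu.le hu' hv.le hv', ← h,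
    zero_rpow hs0.ne'] at h1
  linarith

/-- The instance of subadditivity of the stable tail dependence function comparing
`C u v` with the diagonal. -/
theorem IsExtremeValueCopula.mul_diag_le {C : ℝ → ℝ → ℝ} (hC : IsExtremeValueCopula C)
    {u v : ℝ} (hu : 0 < u) (huv : u ≤ v) (hv' : v ≤ 1) :
    u * C v v ≤ v * C u v := by
  have hv : 0 < v := hu.trans_le huv
  have hc := hC.pos hu (huv.trans hv') hv hv'
  have hd := hC.pos hv hv' hv hv'
  have hlim := (((tendsto_rpow_sub_one_div hc).sub (tendsto_rpow_sub_one_div hd)).add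
    (tendsto_rpow_sub_one_div hv)).sub (tendsto_rpow_sub_one_div hu)
  have hnonneg : 0 ≤ log (C u v) - log (C v v) + log v - log u := by
    refine ge_of_tendsto hlim ?_
    filter_upwards [self_mem_nhdsWithin] with s hs
    have hs : 0 < s := hs
    have h := hC.1.le_add_sub (rpow_nonneg hu.le s) (rpow_le_rpow hu.le huv hs.le)
      (rpow_le_one hv.le hv' hs.le) (rpow_nonneg hv.le s) (rpow_le_one hv.le hv' hs.le)
    rw [hC.2 s hs v v hv.le hv' hv.le hv', hC.2 s hs u v hu.le (huv.trans hv') hv.le hv'] at h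
    rw [← sub_div, ← add_div, ← sub_div]
    exact div_nonneg (by linarith) hs.le
  rw [← log_le_log_iff (mul_pos hu hd) (mul_pos hv hc), log_mul hu.ne' hd.ne',
    log_mul hv.ne' hc.ne']
  linarith

theorem IsExtremeValueCopula.diag_eq_rpow {C : ℝ → ℝ → ℝ} {lam : ℝ}
    (hC : IsExtremeValueCopula C) (hU : HasUpperTailDep C lam) {t : ℝ} (ht : 0 < t)
    (ht' : t ≤ 1) : C t t = t ^ (2 - lam) := by
  set e := exp (-1) with he
  have he0 : 0 < e := exp_pos _
  have he1 : e ≤ 1 := exp_le_one_iff.2 (by norm_num)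
  set κ := -log (C e e) with hκ
  have hpow : ∀ t : ℝ, 0 < t → t < 1 → C t t = t ^ κ := by
    intro t ht ht'
    have hs : 0 < -log t := neg_pos.2 (log_neg ht ht')
    have het : e ^ (-log t) = t := by
      rw [he, ← exp_mul]; simp [exp_log ht]
    have := hC.2 _ hs e e he0.le he1 he0.le he1
    rw [het, rpow_def_of_pos (hC.pos he0 he1 he0 he1)] at this
    rw [this, rpow_def_of_pos ht, hκ]
    ring_nf
  have hlim : Tendsto (fun t : ℝ => (1 - C t t) / (1 - t)) (nhdsWithin 1 (Iio 1)) (nhds κ) := by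
    have h : HasDerivAt (fun t : ℝ => t ^ κ) κ 1 := by
      simpa using hasDerivAt_rpow_const (x := 1) (p := κ) (Or.inl one_ne_zero)
    have := (hasDerivAt_iff_tendsto_slope.1 h).mono_left
      (nhdsWithin_mono 1 fun y (hy : y < 1) => hy.ne)
    refine this.congr' ?_
    filter_upwards [Ioo_mem_nhdsLT (zero_lt_one' ℝ)] with t ht
    rw [hpow t ht.1 ht.2, slope_def_field, one_rpow, ← neg_div_neg_eq, neg_sub, neg_sub]
  have hκ2 : κ = 2 - lam := tendsto_nhds_unique hlim hU
  rcases ht'.eq_or_lt with rfl | h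
  · rw [one_rpow, (hC.1.1 1 zero_le_one le_rfl).2.2.1]
  · rw [hpow t ht h, hκ2]

/-- An extreme value copula dominates the Cuadras-Augé copula with the same upper tail
dependence coefficient. -/
theorem IsExtremeValueCopula.mul_rpow_le {C : ℝ → ℝ → ℝ} {lam : ℝ}
    (hC : IsExtremeValueCopula C) (hU : HasUpperTailDep C lam) {u v : ℝ} (hu : 0 ≤ u)
    (huv : u ≤ v) (hv' : v ≤ 1) : u * v ^ (1 - lam) ≤ C u v := by
  rcases hu.eq_or_lt with rfl | hu
  · simpa using hC.1.nonneg le_rfl zero_le_one huv hv'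
  have hv : 0 < v := hu.trans_le huv
  have h := hC.mul_diag_le hu huv hv'
  rw [hC.diag_eq_rpow hU hv hv', show 2 - lam = 1 + (1 - lam) by ring, rpow_add hv,
    rpow_one] at h
  refine le_of_mul_le_mul_left ?_ hv
  linarith

theorem stmt_9 (C : ℝ → ℝ → ℝ) (lam : ℝ) (hlam : lam ∈ Set.Icc (0:ℝ) 1)
    (hC : IsExtremeValueCopula C) (hU : HasUpperTailDep C lam)
    (μ : Measure (ℝ × ℝ)) [IsProbabilityMeasure μ]
    (hμ : ∀ u v : ℝ, u ∈ Set.Icc (0:ℝ) 1 → v ∈ Set.Icc (0:ℝ) 1 →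
      μ (Set.Icc 0 u ×ˢ Set.Icc 0 v) = ENNReal.ofReal (C u v)) :
    lam / (2 - lam) ≤ 4 * (∫ p : ℝ × ℝ, C p.1 p.2 ∂μ) - 1 := by
  obtain ⟨hlam0, hlam1⟩ := hlam
  set a := 1 - lam with ha_def
  have ha : 0 ≤ a := by linarith
  have hsq : ∀ᵐ p ∂μ, p ∈ Icc (0:ℝ) 1 ×ˢ Icc (0:ℝ) 1 := by
    refine (mem_ae_iff_prob_eq_one (measurableSet_Icc.prod measurableSet_Icc)).2 ?_
    rw [hμ 1 1 ⟨zero_le_one, le_rfl⟩ ⟨zero_le_one, le_rfl⟩,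
      (hC.1.1 1 zero_le_one le_rfl).2.2.1, ENNReal.ofReal_one]
  have hx0 : ∀ᵐ p ∂μ, 0 ≤ p.1 := hsq.mono fun p h => h.1.1
  have hy0 : ∀ᵐ p ∂μ, 0 ≤ p.2 := hsq.mono fun p h => h.2.1
  have hM1 : ∀ᵐ p ∂μ, max p.1 p.2 ≤ 1 := hsq.mono fun p h => max_le h.1.2 h.2.2
  have hM0 : ∀ᵐ p ∂μ, 0 ≤ max p.1 p.2 := hx0.mono fun p h => h.trans (le_max_left _ _)
  have hM : Measurable fun p : ℝ × ℝ => max p.1 p.2 := measurable_fst.max measurable_snd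
  have hrect : ∀ u ∈ Icc (0:ℝ) 1, ∀ v ∈ Icc (0:ℝ) 1,
      μ.real (Icc 0 u ×ˢ Icc 0 v) = C u v := fun u hu v hv => by
    rw [measureReal_def, hμ u v hu hv,
      ENNReal.toReal_ofReal (hC.1.nonneg hu.1 hu.2 hv.1 hv.2)]
  have hlaw : ∀ u ∈ Icc (0:ℝ) 1, ∀ v ∈ Icc (0:ℝ) 1,
      μ.real {p | p.1 ≤ u ∧ p.2 ≤ v} = C u v := fun u hu v hv => by
    rw [← hrect u hu v hv]
    refine measureReal_congr ?_
    filter_upwards [hx0, hy0] with p hx hy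
    refine propext ⟨fun h => ⟨⟨hx, h.1⟩, ⟨hy, h.2⟩⟩, fun h => ⟨h.1.2, h.2.2⟩⟩
  have h11 : (1:ℝ) ∈ Icc (0:ℝ) 1 := ⟨zero_le_one, le_rfl⟩
  have hxmean : ∫ p, p.1 ∂μ = 1 / 2 := by
    refine integral_eq_half_of_uniform μ measurable_fst hx0 (hsq.mono fun p h => h.1.2)
      fun s hs => ?_
    refine Eq.trans (measureReal_congr ?_) ((hlaw s hs 1 h11).trans (hC.1.1 s hs.1 hs.2).2.2.1)
    filter_upwards [hsq] with p hp
    exact propext ⟨fun h => ⟨h, hp.2.2⟩, fun h => h.1⟩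
  have hymean : ∫ p, p.2 ∂μ = 1 / 2 := by
    refine integral_eq_half_of_uniform μ measurable_snd hy0 (hsq.mono fun p h => h.2.2)
      fun s hs => ?_
    refine Eq.trans (measureReal_congr ?_) ((hlaw 1 h11 s hs).trans (hC.1.1 s hs.1 hs.2).2.2.2)
    filter_upwards [hsq] with p hp
    exact propext ⟨fun h => ⟨hp.1.2, h⟩, fun h => h.2⟩
  have hdiag : ∀ t ∈ Icc (0:ℝ) 1, C t t = t * t ^ a := fun t ht => by
    rcases ht.1.eq_or_lt with rfl | h
    · rw [(hC.1.1 0 le_rfl zero_le_one).1, zero_mul]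
    · rw [hC.diag_eq_rpow hU h ht.2, show 2 - lam = 1 + a by rw [ha_def]; ring, rpow_add h,
        rpow_one]
  have hMlaw : ∀ t ∈ Icc (0:ℝ) 1, μ.real {p | max p.1 p.2 ≤ t} = t * t ^ a := fun t ht => by
    simp only [max_le_iff]
    rw [hlaw t ht t ht, hdiag t ht]
  have hxM := le_integral_mul_rpow_of_joint_law μ measurable_fst hM hx0
    (ae_of_all _ fun p => le_max_left _ _) hM1 ha hxmean hMlaw fun t ht u hu => by
      have : {p : ℝ × ℝ | p.1 ≤ u ∧ max p.1 p.2 ≤ t} = {p | p.1 ≤ u ∧ p.2 ≤ t} := by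
        ext p
        simp only [mem_ofPred_eq, max_le_iff]
        exact ⟨fun h => ⟨h.1, h.2.2⟩, fun h => ⟨h.1, h.1.trans hu.2, h.2⟩⟩
      rw [this, hlaw u ⟨hu.1, hu.2.trans ht.2⟩ t ht]
      exact hC.mul_rpow_le hU hu.1 hu.2 ht.2
  have hyM := le_integral_mul_rpow_of_joint_law μ measurable_snd hM hy0
    (ae_of_all _ fun p => le_max_right _ _) hM1 ha hymean hMlaw fun t ht u hu => by
      have : {p : ℝ × ℝ | p.2 ≤ u ∧ max p.1 p.2 ≤ t} = {p | p.1 ≤ t ∧ p.2 ≤ u} := by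
        ext p
        simp only [mem_ofPred_eq, max_le_iff]
        exact ⟨fun h => ⟨h.2.1, h.1⟩, fun h => ⟨h.2, h.1, h.2.trans hu.2⟩⟩
      rw [this, hlaw t ht u ⟨hu.1, hu.2.trans ht.2⟩]
      exact hC.swap.mul_rpow_le hU hu.1 hu.2 ht.2
  have hMM : ∫ p : ℝ × ℝ, max p.1 p.2 * max p.1 p.2 ^ a ∂μ = 1 / 2 := by
    have h1a : 0 < 1 + a := by linarith
    have hpow : ∀ᵐ p : ℝ × ℝ ∂μ, max p.1 p.2 * max p.1 p.2 ^ a = max p.1 p.2 ^ (1 + a) := by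
      filter_upwards [hM0] with p h
      rw [rpow_add_of_nonneg h zero_le_one ha, rpow_one]
    rw [integral_congr_ae hpow]
    refine integral_eq_half_of_uniform μ (hM.pow_const _)
      (hM0.mono fun p h => rpow_nonneg h _)
      (by filter_upwards [hM0, hM1] with p h h' using rpow_le_one h h' h1a.le) fun s hs => ?_
    have hs' : s ^ (1 + a)⁻¹ ∈ Icc (0:ℝ) 1 :=
      ⟨rpow_nonneg hs.1 _, rpow_le_one hs.1 hs.2 (by positivity)⟩
    have hset : μ.real {p | max p.1 p.2 ^ (1 + a) ≤ s} =
        μ.real {p | max p.1 p.2 ≤ s ^ (1 + a)⁻¹} := by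
      refine measureReal_congr ?_
      filter_upwards [hM0] with p h
      exact propext (Real.le_rpow_inv_iff_of_pos h hs.1 h1a).symm
    rw [hset, hMlaw _ hs']
    nth_rewrite 1 [← rpow_one (s ^ (1 + a)⁻¹)]
    rw [← rpow_add_of_nonneg hs'.1 zero_le_one ha, ← rpow_mul hs.1,
      inv_mul_cancel₀ h1a.ne', rpow_one]
  have hintMul : ∀ f : ℝ × ℝ → ℝ, Measurable f → (∀ᵐ p ∂μ, 0 ≤ f p) →
      (∀ p, f p ≤ max p.1 p.2) → Integrable (fun p => f p * max p.1 p.2 ^ a) μ := by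
    intro f hf hf0 hfM
    refine Integrable.of_bound (hf.mul (hM.pow_const a)).aestronglyMeasurable 1 ?_
    filter_upwards [hf0, hM0, hM1] with p h h' h''
    have := rpow_nonneg h' a
    rw [Real.norm_eq_abs, abs_of_nonneg (by positivity)]
    exact mul_le_one₀ ((hfM p).trans h'') this (rpow_le_one h' h'' ha)
  have hix := hintMul _ measurable_fst hx0 fun p => le_max_left _ _
  have hiy := hintMul _ measurable_snd hy0 fun p => le_max_right _ _
  have hiM := hintMul _ hM hM0 fun p => le_rfl
  have hCint : Integrable (fun p : ℝ × ℝ => C p.1 p.2) μ := by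
    have hmeas : Measurable fun p : ℝ × ℝ => μ.real (Icc 0 p.1 ×ˢ Icc 0 p.2) := by
      have hS : MeasurableSet {q : (ℝ × ℝ) × (ℝ × ℝ) |
          (0 ≤ q.2.1 ∧ q.2.1 ≤ q.1.1) ∧ (0 ≤ q.2.2 ∧ q.2.2 ≤ q.1.2)} := by
        measurability
      exact (measurable_measure_prodMk_left hS).ennreal_toReal
    have : Integrable (fun p : ℝ × ℝ => μ.real (Icc 0 p.1 ×ˢ Icc 0 p.2)) μ :=
      Integrable.of_bound hmeas.aestronglyMeasurable 1 (ae_of_all _ fun p => by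
        rw [Real.norm_eq_abs, abs_of_nonneg measureReal_nonneg]
        exact measureReal_le_one)
    refine this.congr ?_
    filter_upwards [hsq] with p hp using hrect _ hp.1 _ hp.2
  have hadd : Integrable
      (fun p : ℝ × ℝ => p.1 * max p.1 p.2 ^ a + p.2 * max p.1 p.2 ^ a) μ := hix.add hiy
  have hlow : ∫ p : ℝ × ℝ, (p.1 * max p.1 p.2 ^ a + p.2 * max p.1 p.2 ^ a
      - max p.1 p.2 * max p.1 p.2 ^ a) ∂μ ≤ ∫ p : ℝ × ℝ, C p.1 p.2 ∂μ := by
    refine integral_mono_ae (hadd.sub hiM) hCint ?_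
    filter_upwards [hsq] with p hp
    rcases le_total p.1 p.2 with h | h
    · have := hC.mul_rpow_le hU hp.1.1 h hp.2.2
      simpa [max_eq_right h] using this
    · have := hC.swap.mul_rpow_le hU hp.2.1 h hp.1.2
      simpa [max_eq_left h] using this
  rw [integral_sub hadd hiM, integral_add hix hiy, hMM] at hlow
  have hfinal : lam / (2 - lam) = 4 * (2 * (1 / 2 - a / (4 * (1 + a))) - 1 / 2) - 1 := by
    have h2 : lam = 1 - a := by rw [ha_def]; ring
    have h3 : 1 + a ≠ 0 := by positivity
    rw [h2, show 2 - (1 - a) = 1 + a by ring]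
    field_simp
    ring
  rw [hfinal]
  linarith
end
end

section
/- Let C be a bivariate extreme value copula with upper tail dependence coefficient λ ∈ [0,1]. Then its Spearman coefficient ρ = 12∫₀¹∫₀¹ C(u,v) du dv − 3 satisfies 3λ/(4−λ) ≤ ρ ≤ 1 − 16((1−λ)/(4−λ))². -/
open MeasureTheory Filter Set Real

noncomputable section

theorem log_add_log_le_of_rpow_add_le {a b c d : ℝ} (ha : 0 < a) (hb : 0 < b) (hc : 0 < c)
    (hd : 0 < d) (h : ∀ s : ℝ, 0 < s → c ^ s + d ^ s ≤ a ^ s + b ^ s) :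
    log c + log d ≤ log a + log b := by
  have key : ∀ x : ℝ, 0 < x → HasDerivAt (fun s : ℝ => x ^ s) (log x) 0 := fun x hx => by
    simpa using (Real.hasStrictDerivAt_const_rpow hx 0).hasDerivAt
  have hder := (((key a ha).add (key b hb)).sub ((key c hc).add (key d hd))).tendsto_slope_zero_right
  have hnn : 0 ≤ log a + log b - (log c + log d) := by
    refine ge_of_tendsto hder ?_
    filter_upwards [self_mem_nhdsWithin] with s hs
    have hs' : (0 : ℝ) < s := hs
    have := h s hs'
    simp only [Pi.sub_apply, Pi.add_apply, zero_add, rpow_zero, smul_eq_mul]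
    have : 0 ≤ s⁻¹ := by positivity
    apply mul_nonneg this
    linarith
  linarith

/-- A continuous function on `[0, ∞)` whose graph lies below its chords at geometric means
is convex. -/
theorem convexOn_Ici_of_geometric {h : ℝ → ℝ} (hc : ContinuousOn h (Ici 0))
    (H : ∀ x r : ℝ, 0 < x → 1 < r → (1 + r) * h x ≤ h (x * r) + r * h (x / r)) :
    ConvexOn ℝ (Ici 0) h := by
  refine LinearOrder.convexOn_of_lt (convex_Ici 0) ?_
  intro x hx y hy hxy a b ha hb hab
  have hx0 : 0 ≤ x := hx
  have hyx : 0 < y - x := by linarith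
  set k := (h y - h x) / (y - x) with hk
  have hkm : k * (y - x) = h y - h x := div_mul_cancel₀ _ hyx.ne'
  set g : ℝ → ℝ := fun z => h z - (h x + k * (z - x)) with hg
  have hgc : ContinuousOn g (Icc x y) :=
    (hc.mono fun z hz => hx0.trans hz.1).sub (by fun_prop)
  have hgx : g x = 0 := by simp [hg]
  have hgy : g y = 0 := by simp only [hg]; linarith
  have Hg : ∀ z r : ℝ, 0 < z → 1 < r → (1 + r) * g z ≤ g (z * r) + r * g (z / r) := by
    intro z r hz hr
    have h1 := H z r hz hr
    have h2 : r * (z / r) = z := by field_simp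
    have h3 : g (z * r) + r * g (z / r) - (1 + r) * g z
        = h (z * r) + r * h (z / r) - (1 + r) * h z - k * (r * (z / r) - z) := by
      simp only [hg]; ring
    rw [h2] at h3
    linarith
  obtain ⟨c, hcm, hmax⟩ := isCompact_Icc.exists_isMaxOn (nonempty_Icc.2 hxy.le) hgc
  have hle : g c ≤ 0 := by
    by_contra! hpos
    have hcx : x < c := lt_of_le_of_ne hcm.1 (by rintro rfl; linarith)
    have hcy : c < y := lt_of_le_of_ne hcm.2 (by rintro rfl; linarith)
    have hc0 : 0 < c := by linarith
    rcases le_total (x * y) (c * c) with hcase | hcase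
    · have hr : 1 < y / c := by rwa [one_lt_div hc0]
      have h1 := Hg c (y / c) hc0 hr
      have h2 : c * (y / c) = y := by field_simp
      have h3 : g (c / (y / c)) ≤ g c := by
        apply hmax
        constructor
        · rw [div_div_eq_mul_div, le_div_iff₀ (by linarith)]; exact hcase
        · rw [div_div_eq_mul_div, div_le_iff₀ (by linarith)]; nlinarith
      rw [h2, hgy] at h1
      nlinarith [mul_le_mul_of_nonneg_left h3 (by linarith : 0 ≤ y / c)]
    · have hx1 : 0 < x := by nlinarith
      have hr : 1 < c / x := by rwa [one_lt_div hx1]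
      have h1 := Hg c (c / x) hc0 hr
      have h2 : c / (c / x) = x := by field_simp
      have h3 : g (c * (c / x)) ≤ g c := by
        apply hmax
        constructor
        · rw [mul_div_assoc', le_div_iff₀ hx1]; nlinarith
        · rw [mul_div_assoc', div_le_iff₀ hx1]; linarith
      rw [h2, hgx] at h1
      nlinarith
  have hmem : a * x + b * y ∈ Icc x y := by
    constructor <;> nlinarith
  have hfin := (hmax hmem).trans hle
  simp only [hg, smul_eq_mul] at hfin ⊢
  have e : a * x + b * y - x = b * (y - x) := by
    have : a = 1 - b := by linarith
    rw [this]; ring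
  rw [e] at hfin
  have e2 : k * (b * (y - x)) = b * (h y - h x) := by rw [← hkm]; ring
  have : a = 1 - b := by linarith
  rw [this] at hfin ⊢
  linarith

theorem ConvexOn.exists_subgradient {S : Set ℝ} {f : ℝ → ℝ} {x : ℝ} (hf : ConvexOn ℝ S f)
    (hx : x ∈ interior S) : ∃ m : ℝ, ∀ y ∈ S, f x + m * (y - x) ≤ f y := by
  refine ⟨derivWithin f (Ioi x) x, fun y hy => ?_⟩
  rcases lt_trichotomy y x with h | rfl | h
  · have h1 := (hf.slope_le_leftDeriv_of_mem_interior hy hx h).trans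
      (hf.leftDeriv_le_rightDeriv_of_mem_interior hx)
    rw [slope_def_field, div_le_iff₀ (by linarith)] at h1
    linarith
  · simp
  · have h1 := hf.rightDeriv_le_slope_of_mem_interior hx hy h
    rw [slope_def_field, le_div_iff₀ (by linarith)] at h1
    linarith

namespace IsCopula

variable {C : ℝ → ℝ → ℝ}

theorem swap_s11 (hC : IsCopula C) : IsCopula fun u v => C v u := by
  refine ⟨fun u h0 h1 => ?_, fun u₁ u₂ v₁ v₂ a b c d e f => ?_⟩
  · obtain ⟨p, q, r, s⟩ := hC.1 u h0 h1
    exact ⟨q, p, s, r⟩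
  · have := hC.2 v₁ v₂ u₁ u₂ d e f a b c
    linarith

theorem mono_left (hC : IsCopula C) {u₁ u₂ v : ℝ} (h0 : 0 ≤ u₁) (h : u₁ ≤ u₂) (h1 : u₂ ≤ 1)
    (hv0 : 0 ≤ v) (hv1 : v ≤ 1) : C u₁ v ≤ C u₂ v := by
  have := hC.2 u₁ u₂ 0 v h0 h h1 le_rfl hv0 hv1
  rw [(hC.1 u₁ h0 (h.trans h1)).1, (hC.1 u₂ (h0.trans h) h1).1] at this
  linarith

theorem mono_right (hC : IsCopula C) {u v₁ v₂ : ℝ} (h0 : 0 ≤ v₁) (h : v₁ ≤ v₂) (h1 : v₂ ≤ 1)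
    (hu0 : 0 ≤ u) (hu1 : u ≤ 1) : C u v₁ ≤ C u v₂ :=
  hC.swap_s11.mono_left h0 h h1 hu0 hu1

theorem sub_le_left (hC : IsCopula C) {u₁ u₂ v : ℝ} (h0 : 0 ≤ u₁) (h : u₁ ≤ u₂) (h1 : u₂ ≤ 1)
    (hv0 : 0 ≤ v) (hv1 : v ≤ 1) : C u₂ v - C u₁ v ≤ u₂ - u₁ := by
  have := hC.2 u₁ u₂ v 1 h0 h h1 hv0 hv1 le_rfl
  rw [(hC.1 u₁ h0 (h.trans h1)).2.2.1, (hC.1 u₂ (h0.trans h) h1).2.2.1] at this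
  linarith

theorem nonneg_s11 (hC : IsCopula C) {u v : ℝ} (hu0 : 0 ≤ u) (hu1 : u ≤ 1) (hv0 : 0 ≤ v)
    (hv1 : v ≤ 1) : 0 ≤ C u v := by
  have := hC.mono_left le_rfl hu0 hu1 hv0 hv1
  rwa [(hC.1 v hv0 hv1).2.1] at this

theorem le_left (hC : IsCopula C) {u v : ℝ} (hu0 : 0 ≤ u) (hu1 : u ≤ 1) (hv0 : 0 ≤ v)
    (hv1 : v ≤ 1) : C u v ≤ u := by
  have := hC.mono_right hv0 hv1 le_rfl hu0 hu1
  rwa [(hC.1 u hu0 hu1).2.2.1] at this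

theorem le_right (hC : IsCopula C) {u v : ℝ} (hu0 : 0 ≤ u) (hu1 : u ≤ 1) (hv0 : 0 ≤ v)
    (hv1 : v ≤ 1) : C u v ≤ v :=
  hC.swap_s11.le_left hv0 hv1 hu0 hu1

theorem add_sub_one_le (hC : IsCopula C) {u v : ℝ} (hu0 : 0 ≤ u) (hu1 : u ≤ 1) (hv0 : 0 ≤ v)
    (hv1 : v ≤ 1) : u + v - 1 ≤ C u v := by
  have := hC.sub_le_left hu0 hu1 le_rfl hv0 hv1
  rw [(hC.1 v hv0 hv1).2.2.2] at this
  linarith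

theorem continuousOn_left (hC : IsCopula C) {v : ℝ} (hv0 : 0 ≤ v) (hv1 : v ≤ 1) :
    ContinuousOn (fun u => C u v) (Icc 0 1) := by
  refine LipschitzOnWith.continuousOn (K := 1) (LipschitzOnWith.of_le_add ?_)
  intro x hx y hy
  rcases le_total x y with h | h
  · have := hC.mono_left hx.1 h hy.2 hv0 hv1
    linarith [dist_nonneg (x := x) (y := y)]
  · have := hC.sub_le_left hy.1 h hx.2 hv0 hv1
    rw [Real.dist_eq, abs_of_nonneg (by linarith)]
    linarith

theorem intervalIntegrable_right (hC : IsCopula C) {u a b : ℝ} (hu0 : 0 ≤ u) (hu1 : u ≤ 1)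
    (ha : a ∈ Icc (0 : ℝ) 1) (hb : b ∈ Icc (0 : ℝ) 1) :
    IntervalIntegrable (fun v => C u v) volume a b := by
  refine MonotoneOn.intervalIntegrable fun x hx y hy hxy => ?_
  have hsub := uIcc_subset_Icc ha hb
  exact hC.mono_right (hsub hx).1 hxy (hsub hy).2 hu0 hu1

theorem intervalIntegrable_integral (hC : IsCopula C) :
    IntervalIntegrable (fun u => ∫ v in (0 : ℝ)..1, C u v) volume 0 1 := by
  have h0 : (0 : ℝ) ∈ Icc (0 : ℝ) 1 := by simp
  have h1 : (1 : ℝ) ∈ Icc (0 : ℝ) 1 := by simp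
  refine MonotoneOn.intervalIntegrable fun x hx y hy hxy => ?_
  rw [uIcc_of_le zero_le_one] at hx hy
  exact intervalIntegral.integral_mono_on zero_le_one
    (hC.intervalIntegrable_right hx.1 hx.2 h0 h1) (hC.intervalIntegrable_right hy.1 hy.2 h0 h1)
    fun v hv => hC.mono_left hx.1 hxy hy.2 hv.1 hv.2

end IsCopula

/-- The stable tail dependence function `L(x, y) = -log C(e⁻ˣ, e⁻ʸ)`. -/
def stableTail (C : ℝ → ℝ → ℝ) (x y : ℝ) : ℝ := -log (C (exp (-x)) (exp (-y)))

namespace IsExtremeValueCopula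

variable {C : ℝ → ℝ → ℝ}

theorem swap_s11 (hC : IsExtremeValueCopula C) : IsExtremeValueCopula fun u v => C v u :=
  ⟨hC.1.swap_s11, fun s hs u v a b c d => hC.2 s hs v u c d a b⟩

theorem pos_s11 (hC : IsExtremeValueCopula C) {u v : ℝ} (hu0 : 0 < u) (hu1 : u ≤ 1) (hv0 : 0 < v)
    (hv1 : v ≤ 1) : 0 < C u v := by
  refine lt_of_le_of_ne (hC.1.nonneg_s11 hu0.le hu1 hv0.le hv1) fun h => ?_
  have key : ∀ x : ℝ, 0 < x → Tendsto (fun s : ℝ => x ^ s) (nhdsWithin 0 (Ioi 0)) (nhds 1) :=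
    fun x hx => by
      have := (Real.hasStrictDerivAt_const_rpow hx 0).hasDerivAt.continuousAt.tendsto
      rw [rpow_zero] at this
      exact this.mono_left nhdsWithin_le_nhds
  have hlim : Tendsto (fun s : ℝ => u ^ s + v ^ s - 1) (nhdsWithin 0 (Ioi 0)) (nhds (1 + 1 - 1)) :=
    ((key u hu0).add (key v hv0)).sub_const 1
  have : (1 + 1 - 1 : ℝ) ≤ 0 := by
    refine le_of_tendsto hlim ?_
    filter_upwards [self_mem_nhdsWithin] with s hs
    have hs' : (0 : ℝ) < s := hs
    have h1 := hC.1.add_sub_one_le (rpow_nonneg hu0.le s) (rpow_le_one hu0.le hu1 hs'.le)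
      (rpow_nonneg hv0.le s) (rpow_le_one hv0.le hv1 hs'.le)
    rw [hC.2 s hs' u v hu0.le hu1 hv0.le hv1, ← h, zero_rpow hs'.ne'] at h1
    exact h1
  norm_num at this

theorem pos_exp_neg (hC : IsExtremeValueCopula C) {x y : ℝ} (hx : 0 ≤ x) (hy : 0 ≤ y) :
    0 < C (exp (-x)) (exp (-y)) :=
  hC.pos_s11 (exp_pos _) (exp_le_one_iff.2 (by linarith)) (exp_pos _) (exp_le_one_iff.2 (by linarith))

theorem eq_exp_neg_stableTail (hC : IsExtremeValueCopula C) {u v : ℝ} (hu0 : 0 < u) (hu1 : u ≤ 1)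
    (hv0 : 0 < v) (hv1 : v ≤ 1) : C u v = exp (-stableTail C (-log u) (-log v)) := by
  simp only [stableTail, neg_neg, exp_log hu0, exp_log hv0]
  rw [exp_log (hC.pos_s11 hu0 hu1 hv0 hv1)]

theorem stableTail_mul (hC : IsExtremeValueCopula C) {s x y : ℝ} (hs : 0 < s) (hx : 0 ≤ x)
    (hy : 0 ≤ y) : stableTail C (s * x) (s * y) = s * stableTail C x y := by
  have e : ∀ z : ℝ, exp (-(s * z)) = exp (-z) ^ s := fun z => by
    rw [← exp_mul]; congr 1; ring
  unfold stableTail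
  rw [e, e, hC.2 s hs _ _ (exp_pos _).le (exp_le_one_iff.2 (by linarith)) (exp_pos _).le
    (exp_le_one_iff.2 (by linarith)), log_rpow (hC.pos_exp_neg hx hy)]
  ring

theorem stableTail_zero_right (hC : IsExtremeValueCopula C) {x : ℝ} (hx : 0 ≤ x) :
    stableTail C x 0 = x := by
  have := (hC.1.1 (exp (-x)) (exp_pos _).le (exp_le_one_iff.2 (by linarith))).2.2.1
  simp [stableTail, this]

theorem stableTail_zero_left (hC : IsExtremeValueCopula C) {y : ℝ} (hy : 0 ≤ y) :
    stableTail C 0 y = y :=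
  hC.swap_s11.stableTail_zero_right hy

theorem stableTail_submodular (hC : IsExtremeValueCopula C) {x₁ x₂ y₁ y₂ : ℝ} (hx₁ : 0 ≤ x₁)
    (hx : x₁ ≤ x₂) (hy₁ : 0 ≤ y₁) (hy : y₁ ≤ y₂) :
    stableTail C x₂ y₂ + stableTail C x₁ y₁ ≤ stableTail C x₂ y₁ + stableTail C x₁ y₂ := by
  have hx₂ := hx₁.trans hx
  have hy₂ := hy₁.trans hy
  have e1 : ∀ z : ℝ, 0 ≤ z → exp (-z) ≤ 1 := fun z hz => exp_le_one_iff.2 (by linarith)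
  have := log_add_log_le_of_rpow_add_le (hC.pos_exp_neg hx₂ hy₂) (hC.pos_exp_neg hx₁ hy₁)
    (hC.pos_exp_neg hx₂ hy₁) (hC.pos_exp_neg hx₁ hy₂) fun s hs => by
      have p : ∀ z : ℝ, 0 ≤ exp (-z) := fun z => (exp_pos _).le
      rw [← hC.2 s hs _ _ (p _) (e1 _ hx₂) (p _) (e1 _ hy₂),
        ← hC.2 s hs _ _ (p _) (e1 _ hx₁) (p _) (e1 _ hy₁),
        ← hC.2 s hs _ _ (p _) (e1 _ hx₂) (p _) (e1 _ hy₁),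
        ← hC.2 s hs _ _ (p _) (e1 _ hx₁) (p _) (e1 _ hy₂)]
      have := hC.1.2 (exp (-x₂) ^ s) (exp (-x₁) ^ s) (exp (-y₂) ^ s) (exp (-y₁) ^ s)
        (rpow_nonneg (p _) s) (rpow_le_rpow (p _) (exp_le_exp.2 (by linarith)) hs.le)
        (rpow_le_one (p _) (e1 _ hx₁) hs.le)
        (rpow_nonneg (p _) s) (rpow_le_rpow (p _) (exp_le_exp.2 (by linarith)) hs.le)
        (rpow_le_one (p _) (e1 _ hy₁) hs.le)
      linarith
  unfold stableTail
  linarith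

theorem stableTail_le_add (hC : IsExtremeValueCopula C) {x y : ℝ} (hx : 0 ≤ x) (hy : 0 ≤ y) :
    stableTail C x y ≤ x + y := by
  have := hC.stableTail_submodular le_rfl hx le_rfl hy
  rw [hC.stableTail_zero_right hx, hC.stableTail_zero_left hy,
    hC.stableTail_zero_right le_rfl] at this
  linarith

theorem stableTail_eq_mul_div (hC : IsExtremeValueCopula C) {x y : ℝ} (hx : 0 ≤ x) (hy : 0 < y) :
    stableTail C x y = y * stableTail C (x / y) 1 := by
  rw [← hC.stableTail_mul hy (by positivity) zero_le_one, mul_one, mul_div_cancel₀ _ hy.ne']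

theorem continuousOn_stableTail (hC : IsExtremeValueCopula C) :
    ContinuousOn (fun x => stableTail C x 1) (Ici 0) := by
  have h1 : exp (-1 : ℝ) ≤ 1 := exp_le_one_iff.2 (by norm_num)
  have : ContinuousOn (fun x : ℝ => C (exp (-x)) (exp (-1))) (Ici 0) :=
    (hC.1.continuousOn_left (exp_pos _).le h1).comp (by fun_prop)
      fun x hx => ⟨(exp_pos _).le, exp_le_one_iff.2 (by simpa using hx)⟩
  exact (this.log fun x hx => (hC.pos_exp_neg hx zero_le_one).ne').neg

theorem convexOn_stableTail (hC : IsExtremeValueCopula C) :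
    ConvexOn ℝ (Ici 0) fun x => stableTail C x 1 := by
  refine convexOn_Ici_of_geometric hC.continuousOn_stableTail fun x r hx hr => ?_
  have hr0 : 0 < r := by linarith
  have h := hC.stableTail_submodular hx.le (by nlinarith : x ≤ x * r) zero_le_one hr.le
  rw [hC.stableTail_eq_mul_div (by positivity) hr0, hC.stableTail_eq_mul_div hx.le hr0,
    mul_div_cancel_right₀ _ hr0.ne'] at h
  linarith

theorem stableTail_one_one (hC : IsExtremeValueCopula C) {lam : ℝ} (hU : HasUpperTailDep C lam) :
    stableTail C 1 1 = 2 - lam := by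
  refine tendsto_nhds_unique ?_ hU
  have hd := (Real.hasDerivAt_rpow_const (x := 1) (p := stableTail C 1 1)
    (Or.inl one_ne_zero)).tendsto_slope
  rw [one_rpow, mul_one] at hd
  refine (hd.mono_left (nhdsWithin_mono _ fun t (ht : t < 1) => ht.ne)).congr' ?_
  filter_upwards [Ioo_mem_nhdsLT (zero_lt_one (α := ℝ))] with t ht
  have hlog : 0 < -log t := by linarith [log_neg ht.1 ht.2]
  rw [hC.eq_exp_neg_stableTail ht.1 ht.2.le ht.1 ht.2.le, hC.stableTail_eq_mul_div hlog.le hlog,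
    div_self hlog.ne', slope_def_field, one_rpow, rpow_def_of_pos ht.1, ← neg_div_neg_eq]
  congr 1
  · rw [show -(-log t * stableTail C 1 1) = log t * stableTail C 1 1 by ring]; ring
  · ring

/-- Lower bound by the Cuadras–Augé copula. -/
theorem mul_rpow_le_s11 (hC : IsExtremeValueCopula C) {u v : ℝ} (hv0 : 0 < v) (hvu : v ≤ u)
    (hu1 : u ≤ 1) : v * u ^ (stableTail C 1 1 - 1) ≤ C u v := by
  have hu0 := hv0.trans_le hvu
  rw [hC.eq_exp_neg_stableTail hu0 hu1 hv0 (hvu.trans hu1)]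
  set x := -log u with hx
  set y := -log v with hy
  have hx0 : 0 ≤ x := by linarith [log_nonpos hu0.le hu1]
  have hxy : x ≤ y := by linarith [log_le_log hv0 hvu]
  have hL : stableTail C x y ≤ x * stableTail C 1 1 + (y - x) := by
    rcases hx0.eq_or_lt with h | h
    · rw [← h, hC.stableTail_zero_left (hx0.trans hxy)]; linarith
    · have hy0 : 0 < y := h.trans_le hxy
      have hw : x / y ≤ 1 := (div_le_one hy0).2 hxy
      have := hC.convexOn_stableTail.2 (mem_Ici.2 zero_le_one) (mem_Ici.2 le_rfl)
        (by positivity : 0 ≤ x / y) (by linarith : 0 ≤ 1 - x / y) (by ring)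
      simp only [smul_eq_mul, mul_one, mul_zero, add_zero,
        hC.stableTail_zero_left zero_le_one] at this
      rw [hC.stableTail_eq_mul_div hx0 hy0]
      have h2 := mul_le_mul_of_nonneg_left this hy0.le
      have h3 : y * (x / y) = x := mul_div_cancel₀ _ hy0.ne'
      calc _ ≤ _ := h2
        _ = (y * (x / y)) * stableTail C 1 1 + (y - y * (x / y)) := by ring
        _ = _ := by rw [h3]
  rw [rpow_def_of_pos hu0]
  nth_rewrite 1 [← exp_log hv0]
  rw [← exp_add]
  apply exp_le_exp.2
  have hxu : log u = -x := by simp [hx]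
  have hyv : log v = -y := by simp [hy]
  rw [hxu, hyv]
  linarith

/-- Upper bound by a supporting line of the stable tail dependence function. -/
theorem exists_le_rpow_mul_rpow (hC : IsExtremeValueCopula C) :
    ∃ a b : ℝ, a ≤ 1 ∧ b ≤ 1 ∧ a + b = stableTail C 1 1 ∧
      ∀ u v : ℝ, 0 < u → u ≤ 1 → 0 < v → v < 1 → C u v ≤ u ^ a * v ^ b := by
  obtain ⟨m, hm⟩ := hC.convexOn_stableTail.exists_subgradient (x := 1) (by simp)
  refine ⟨m, stableTail C 1 1 - m, ?_, ?_, by ring, ?_⟩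
  · by_contra! h
    have h2 := hC.stableTail_le_add zero_le_one zero_le_one
    have h0 : 0 ≤ (2 + m - stableTail C 1 1) / (m - 1) :=
      div_nonneg (by linarith) (by linarith)
    have h1 := (hm _ h0).trans (hC.stableTail_le_add h0 zero_le_one)
    have h3 : (2 + m - stableTail C 1 1) / (m - 1) * (m - 1) = 2 + m - stableTail C 1 1 :=
      div_mul_cancel₀ _ (by linarith)
    nlinarith
  · have := hm 0 (by simp)
    simp only [hC.stableTail_zero_left zero_le_one] at this
    linarith
  · intro u v hu0 hu1 hv0 hv1
    rw [hC.eq_exp_neg_stableTail hu0 hu1 hv0 hv1.le, rpow_def_of_pos hu0, rpow_def_of_pos hv0,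
      ← exp_add]
    apply exp_le_exp.2
    have hx0 : 0 ≤ -log u := by linarith [log_nonpos hu0.le hu1]
    have hy0 : 0 < -log v := by linarith [log_neg hv0 hv1]
    rw [hC.stableTail_eq_mul_div hx0 hy0]
    have h1 := mul_le_mul_of_nonneg_left (hm (-log u / -log v) (mem_Ici.2 (by positivity))) hy0.le
    have h3 : -log v * (-log u / -log v) = -log u := mul_div_cancel₀ _ hy0.ne'
    have h4 : -log v * (stableTail C 1 1 + m * (-log u / -log v - 1))
      = -log v * stableTail C 1 1 + m * (-log v * (-log u / -log v) + log v) := by ring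
    rw [h4, h3] at h1
    linarith

end IsExtremeValueCopula

theorem intervalIntegrable_rpow_combination (p q r : ℝ) {k m : ℝ} (hk : 0 ≤ k) (hm : 0 ≤ m) :
    IntervalIntegrable (fun u : ℝ => p * u ^ k + q * u ^ m + r * u) volume 0 1 :=
  (((intervalIntegral.intervalIntegrable_rpow (Or.inl hk)).const_mul p).add
    ((intervalIntegral.intervalIntegrable_rpow (Or.inl hm)).const_mul q)).add
    (intervalIntegral.intervalIntegrable_id.const_mul r)

theorem integral_rpow_combination (p q r : ℝ) {k m : ℝ} (hk : 0 ≤ k) (hm : 0 ≤ m) :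
    ∫ u in (0 : ℝ)..1, (p * u ^ k + q * u ^ m + r * u) = p / (k + 1) + q / (m + 1) + r / 2 := by
  have ik : IntervalIntegrable (fun u : ℝ => p * u ^ k) volume 0 1 :=
    (intervalIntegral.intervalIntegrable_rpow (Or.inl hk)).const_mul p
  have im : IntervalIntegrable (fun u : ℝ => q * u ^ m) volume 0 1 :=
    (intervalIntegral.intervalIntegrable_rpow (Or.inl hm)).const_mul q
  have ir : IntervalIntegrable (fun u : ℝ => r * u) volume 0 1 :=
    intervalIntegral.intervalIntegrable_id.const_mul r
  rw [intervalIntegral.integral_add (ik.add im) ir, intervalIntegral.integral_add ik im,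
    intervalIntegral.integral_const_mul, intervalIntegral.integral_const_mul,
    intervalIntegral.integral_const_mul, integral_rpow (Or.inl (by linarith)),
    integral_rpow (Or.inl (by linarith)), integral_id, one_rpow, one_rpow,
    zero_rpow (by linarith), zero_rpow (by linarith)]
  ring

namespace IsCopula

variable {C : ℝ → ℝ → ℝ}

theorem integral_le (hC : IsCopula C) {p q k m : ℝ} (hk : 0 ≤ k) (hm : 0 ≤ m)
    (h : ∀ u : ℝ, 0 < u → u < 1 → ∫ v in (0 : ℝ)..1, C u v ≤ p * u ^ k + q * u ^ m + 1 * u) :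
    ∫ u in (0 : ℝ)..1, ∫ v in (0 : ℝ)..1, C u v ≤ p / (k + 1) + q / (m + 1) + 1 / 2 := by
  rw [← integral_rpow_combination p q 1 hk hm]
  exact intervalIntegral.integral_mono_on_of_le_Ioo zero_le_one hC.intervalIntegrable_integral
    (intervalIntegrable_rpow_combination p q 1 hk hm) fun u hu => h u hu.1 hu.2

theorem integral_right_le (hC : IsCopula C) {a b u s t : ℝ} (hb : 0 ≤ b) (hu0 : 0 < u)
    (hu1 : u < 1) (h : ∀ v : ℝ, 0 < v → v < 1 → C u v ≤ u ^ a * v ^ b) (hs : 0 ≤ s) (hst : s ≤ t)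
    (ht : t ≤ 1) :
    ∫ v in (0 : ℝ)..1, C u v
      ≤ s ^ 2 / 2 + u ^ a * ((t ^ (b + 1) - s ^ (b + 1)) / (b + 1)) + u * (1 - t) := by
  have m0 : (0 : ℝ) ∈ Icc (0 : ℝ) 1 := by simp
  have m1 : (1 : ℝ) ∈ Icc (0 : ℝ) 1 := by simp
  have ms : s ∈ Icc (0 : ℝ) 1 := ⟨hs, hst.trans ht⟩
  have mt : t ∈ Icc (0 : ℝ) 1 := ⟨hs.trans hst, ht⟩
  have int : ∀ {x y : ℝ}, x ∈ Icc (0 : ℝ) 1 → y ∈ Icc (0 : ℝ) 1 →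
      IntervalIntegrable (fun v => C u v) volume x y :=
    fun hx hy => hC.intervalIntegrable_right hu0.le hu1.le hx hy
  rw [← intervalIntegral.integral_add_adjacent_intervals (int m0 mt) (int mt m1),
    ← intervalIntegral.integral_add_adjacent_intervals (int m0 ms) (int ms mt)]
  have h1 : ∫ v in (0 : ℝ)..s, C u v ≤ ∫ v in (0 : ℝ)..s, v :=
    intervalIntegral.integral_mono_on_of_le_Ioo hs (int m0 ms)
      intervalIntegral.intervalIntegrable_id
      fun v hv => hC.le_right hu0.le hu1.le hv.1.le (hv.2.le.trans ms.2)
  have h2 : ∫ v in s..t, C u v ≤ ∫ v in s..t, u ^ a * v ^ b :=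
    intervalIntegral.integral_mono_on_of_le_Ioo hst (int ms mt)
      ((intervalIntegral.intervalIntegrable_rpow (Or.inl hb)).const_mul _)
      fun v hv => h v (hs.trans_lt hv.1) (hv.2.trans_le ht)
  have h3 : ∫ v in t..1, C u v ≤ ∫ v in t..1, u :=
    intervalIntegral.integral_mono_on_of_le_Ioo ht (int mt m1)
      intervalIntegrable_const
      fun v hv => hC.le_left hu0.le hu1.le (mt.1.trans hv.1.le) hv.2.le
  rw [integral_id] at h1
  rw [intervalIntegral.integral_const_mul, integral_rpow (Or.inl (by linarith))] at h2
  rw [intervalIntegral.integral_const, smul_eq_mul] at h3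
  linarith

end IsCopula

namespace IsExtremeValueCopula

variable {C : ℝ → ℝ → ℝ}

theorem le_integral (hC : IsExtremeValueCopula C) (h1 : 1 ≤ stableTail C 1 1) :
    1 / (stableTail C 1 1 + 2) ≤ ∫ u in (0 : ℝ)..1, ∫ v in (0 : ℝ)..1, C u v := by
  set c := stableTail C 1 1
  have hint := integral_rpow_combination (1 / 2 - 1 / c) 0 (1 / c) (k := c + 1) (m := 0)
    (by linarith) le_rfl
  have hval : (1 / 2 - 1 / c) / (c + 1 + 1) + 0 / (0 + 1) + 1 / c / 2 = 1 / (c + 2) := by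
    have : c ≠ 0 := by linarith
    have : c + 2 ≠ 0 := by linarith
    rw [show c + 1 + 1 = c + 2 by ring]
    field_simp
    ring
  rw [← hval, ← hint]
  refine intervalIntegral.integral_mono_on_of_le_Ioo zero_le_one
    (intervalIntegrable_rpow_combination _ _ _ (by linarith) le_rfl)
    hC.1.intervalIntegrable_integral fun u hu => ?_
  have m0 : (0 : ℝ) ∈ Icc (0 : ℝ) 1 := by simp
  have m1 : (1 : ℝ) ∈ Icc (0 : ℝ) 1 := by simp
  have mu : u ∈ Icc (0 : ℝ) 1 := ⟨hu.1.le, hu.2.le⟩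
  have i0 := hC.1.intervalIntegrable_right mu.1 mu.2 m0 mu
  have i1 := hC.1.intervalIntegrable_right mu.1 mu.2 mu m1
  rw [← intervalIntegral.integral_add_adjacent_intervals i0 i1]
  have h1 : ∫ v in (0 : ℝ)..u, v * u ^ (c - 1) ≤ ∫ v in (0 : ℝ)..u, C u v :=
    intervalIntegral.integral_mono_on_of_le_Ioo mu.1
      (intervalIntegral.intervalIntegrable_id.mul_const _) i0
      fun v hv => hC.mul_rpow_le_s11 hv.1 hv.2.le mu.2
  have h2 : ∫ v in u..1, u * v ^ (c - 1) ≤ ∫ v in u..1, C u v :=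
    intervalIntegral.integral_mono_on_of_le_Ioo mu.2
      ((intervalIntegral.intervalIntegrable_rpow (Or.inl (by linarith))).const_mul _) i1
      fun v hv => hC.swap_s11.mul_rpow_le_s11 hu.1 hv.1.le hv.2.le
  rw [intervalIntegral.integral_mul_const, integral_id] at h1
  rw [intervalIntegral.integral_const_mul, integral_rpow (Or.inl (by linarith)), one_rpow,
    sub_add_cancel] at h2
  have e1 : u ^ (c - 1) = u ^ c / u := rpow_sub_one hu.1.ne' c
  have e2 : u ^ (c + 1) = u ^ c * u := rpow_add_one hu.1.ne' c
  have e3 : (u ^ 2 - 0 ^ 2) / 2 * u ^ (c - 1) = 1 / 2 * u ^ (c + 1) := by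
    rw [e1, e2]
    have := hu.1.ne'
    field_simp
    ring
  have e4 : u * ((1 - u ^ c) / c) = 1 / c * u - 1 / c * u ^ (c + 1) := by
    rw [e2]; ring
  rw [e3] at h1
  rw [e4] at h2
  linarith

theorem integral_le (hC : IsExtremeValueCopula C) (h1 : 1 ≤ stableTail C 1 1) :
    ∫ u in (0 : ℝ)..1, ∫ v in (0 : ℝ)..1, C u v
      ≤ (4 * stableTail C 1 1 - stableTail C 1 1 ^ 2) / (stableTail C 1 1 + 2) ^ 2 := by
  obtain ⟨a, b, ha1, hb1, hab, hCab⟩ := hC.exists_le_rpow_mul_rpow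
  rw [← hab] at h1 ⊢
  rcases h1.eq_or_lt with hone | hone
  · refine (hC.1.integral_le (p := -1 / 2) (q := 0) (k := 2) (m := 0) (by norm_num) le_rfl
      fun u hu0 hu1 => ?_).trans ?_
    · have := hC.1.integral_right_le (by linarith) hu0 hu1
        (fun v hv0 hv1 => hCab u v hu0 hu1.le hv0 hv1) hu0.le le_rfl hu1.le
      rw [rpow_two]
      simp only [sub_self, zero_div, mul_zero] at this
      linarith
    · rw [← hone]; norm_num
  have ha0 : 0 < a := by linarith
  have hb0 : 0 < b := by linarith
  set m := (1 - a) / b with hm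
  have hm0 : 0 ≤ m := div_nonneg (by linarith) hb0.le
  have hm1 : m ≤ 1 := (div_le_one hb0).2 (by linarith)
  have hmb : m * b = 1 - a := div_mul_cancel₀ _ hb0.ne'
  have eqm : ∀ u : ℝ, 0 < u → u ^ a * (u ^ m) ^ (b + 1) = u ^ (1 + m) := fun u hu => by
    rw [← rpow_mul hu.le, ← rpow_add hu]
    congr 1
    linarith
  have eqm1 : ∀ u : ℝ, 0 < u → u * u ^ m = u ^ (1 + m) := fun u hu => by
    rw [rpow_add hu, rpow_one]
  rcases hb1.eq_or_lt with hb | hb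
  · refine (hC.1.integral_le (p := 0) (q := -1 / 2) (k := 0) (m := 1 + m) le_rfl (by linarith)
      fun u hu0 hu1 => ?_).trans ?_
    · have := hC.1.integral_right_le hb0.le hu0 hu1
        (fun v hv0 hv1 => hCab u v hu0 hu1.le hv0 hv1)
        le_rfl (rpow_nonneg hu0.le m) (rpow_le_one hu0.le hu1.le hm0)
      have e := eqm u hu0
      have e1 := eqm1 u hu0
      rw [zero_rpow (by linarith), sub_zero, mul_div_assoc', e, mul_sub, e1, hb] at this
      linarith
    · have hma : m = 1 - a := by rw [hm, hb, div_one]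
      rw [hma, hb, zero_div, zero_add, div_add_div _ _ (by linarith) two_ne_zero,
        div_le_div_iff₀ (by linarith) (by positivity)]
      nlinarith [mul_nonneg (sq_nonneg (1 - a)) ha0.le, sq_nonneg (1 - a),
        mul_nonneg (sq_nonneg (1 - a)) (sq_nonneg a)]
  · have hb' : 0 < 1 - b := by linarith
    set k := a / (1 - b) with hk
    have hk1 : 1 ≤ k := (one_le_div hb').2 (by linarith)
    have hkb : k * (1 - b) = a := div_mul_cancel₀ _ hb'.ne'
    have eqk : ∀ u : ℝ, 0 < u → u ^ a * (u ^ k) ^ (b + 1) = u ^ (2 * k) := fun u hu => by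
      rw [← rpow_mul hu.le, ← rpow_add hu]
      congr 1
      linarith
    have eqk2 : ∀ u : ℝ, 0 < u → (u ^ k) ^ 2 = u ^ (2 * k) := fun u hu => by
      rw [← rpow_natCast, ← rpow_mul hu.le, mul_comm k]
      norm_num
    refine (hC.1.integral_le (p := 1 / 2 - 1 / (b + 1)) (q := 1 / (b + 1) - 1) (k := 2 * k)
      (m := 1 + m) (by linarith) (by linarith) fun u hu0 hu1 => ?_).trans ?_
    · have := hC.1.integral_right_le hb0.le hu0 hu1
        (fun v hv0 hv1 => hCab u v hu0 hu1.le hv0 hv1)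
        (rpow_nonneg hu0.le k) (rpow_le_rpow_of_exponent_ge hu0 hu1.le (hm1.trans hk1))
        (rpow_le_one hu0.le hu1.le hm0)
      rw [mul_div_assoc', mul_sub, mul_sub, eqm u hu0, eqk u hu0, eqk2 u hu0, eqm1 u hu0] at this
      refine this.trans_eq ?_
      ring
    · have d1 : 0 < 1 + 2 * a - b := by linarith
      have d2 : 0 < 1 + 2 * b - a := by linarith
      have f1 : 2 * k + 1 = (1 + 2 * a - b) / (1 - b) := by
        rw [hk]; field_simp; ring
      have f2 : 1 + m + 1 = (1 + 2 * b - a) / b := by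
        rw [hm]; field_simp; ring
      have key : (1 / 2 - 1 / (b + 1)) / (2 * k + 1) + (1 / (b + 1) - 1) / (1 + m + 1) + 1 / 2
          = (a + b - (a - b) ^ 2 - a * b) / ((1 + 2 * a - b) * (1 + 2 * b - a)) := by
        rw [f1, f2]
        field_simp
        ring
      rw [key, div_le_div_iff₀ (by positivity) (by positivity)]
      nlinarith [mul_nonneg (sq_nonneg (a - b)) (sq_nonneg (a + b - 1))]

end IsExtremeValueCopula

theorem stmt_11 (C : ℝ → ℝ → ℝ) (lam : ℝ) (hlam : lam ∈ Set.Icc (0:ℝ) 1)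
    (hC : IsExtremeValueCopula C) (hU : HasUpperTailDep C lam) :
    3 * lam / (4 - lam)
        ≤ 12 * (∫ u in (0:ℝ)..1, ∫ v in (0:ℝ)..1, C u v) - 3 ∧
    12 * (∫ u in (0:ℝ)..1, ∫ v in (0:ℝ)..1, C u v) - 3
        ≤ 1 - 16 * ((1 - lam) / (4 - lam)) ^ 2 := by
  have hc := hC.stableTail_one_one hU
  have h1 : 1 ≤ stableTail C 1 1 := by linarith [hlam.2]
  have hlow := hC.le_integral h1
  have hup := hC.integral_le h1
  rw [hc, show 2 - lam + 2 = 4 - lam by ring] at hlow hup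
  have h4 : 4 - lam ≠ 0 := by linarith [hlam.2]
  constructor
  · have : 3 * lam / (4 - lam) = 12 * (1 / (4 - lam)) - 3 := by field_simp; ring
    linarith
  · have : 1 - 16 * ((1 - lam) / (4 - lam)) ^ 2
        = 12 * ((4 * (2 - lam) - (2 - lam) ^ 2) / (4 - lam) ^ 2) - 3 := by field_simp; ring
    linarith
end
end

section
/- For α, β ∈ [0,1] with (α,β) ≠ (0,0), let C(u,v) = min{u^(1-α)·v, u·v^(1-β)} be the Marshall–Olkin copula and let μ be the probability measure on [0,1]² with μ([0,u]×[0,v]) = C(u,v). Then Kendall's coefficient τ = 4∫ C dμ − 1 equals αβ/(α − αβ + β). In particular, for α = β = λ, τ = λ/(2 − λ). -/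
open MeasureTheory Filter Set Real

noncomputable section

/-- The uniform distribution on the unit interval. -/
def unitUniform : Measure ℝ := volume.restrict (Ioc 0 1)

instance : IsProbabilityMeasure unitUniform :=
  ⟨by simp [unitUniform]⟩

lemma unitUniform_Iic {c : ℝ} (hc : c ∈ Icc (0 : ℝ) 1) :
    unitUniform (Iic c) = ENNReal.ofReal c := by
  rw [unitUniform, Measure.restrict_apply measurableSet_Iic, inter_comm, Ioc_inter_Iic,
    min_eq_right hc.2]
  simp

lemma ae_unitUniform_mem : ∀ᵐ x ∂unitUniform, x ∈ Ioc (0 : ℝ) 1 :=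
  ae_restrict_mem measurableSet_Ioc

lemma ae_unitUniform_prod_mem :
    ∀ᵐ z ∂unitUniform.prod unitUniform, z.1 ∈ Ioc (0 : ℝ) 1 ∧ z.2 ∈ Ioc (0 : ℝ) 1 := by
  filter_upwards [Measure.quasiMeasurePreserving_fst.ae ae_unitUniform_mem,
    Measure.quasiMeasurePreserving_snd.ae ae_unitUniform_mem] with z h1 h2 using ⟨h1, h2⟩

lemma lintegral_unitUniform : ∫⁻ w, ENNReal.ofReal w ∂unitUniform = ENNReal.ofReal (1 / 2) := by
  rw [← ofReal_integral_eq_lintegral_ofReal]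
  · rw [unitUniform, ← intervalIntegral.integral_of_le zero_le_one, integral_id]
    norm_num
  · exact (continuous_id.integrableOn_Icc (a := (0 : ℝ)) (b := 1)).mono_set Ioc_subset_Icc_self
  · filter_upwards [ae_unitUniform_mem] with w hw using hw.1.le

lemma lintegral_unitUniform_prod_mul :
    ∫⁻ z, ENNReal.ofReal (z.1 * z.2) ∂unitUniform.prod unitUniform = ENNReal.ofReal (1 / 4) := by
  have h : ∫⁻ z, ENNReal.ofReal (z.1 * z.2) ∂unitUniform.prod unitUniform =
      ∫⁻ z, ENNReal.ofReal z.1 * ENNReal.ofReal z.2 ∂unitUniform.prod unitUniform := by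
    refine lintegral_congr_ae ?_
    filter_upwards [ae_unitUniform_prod_mem] with z hz
    exact ENNReal.ofReal_mul hz.1.1.le
  rw [h, lintegral_prod_mul (by fun_prop) (by fun_prop), lintegral_unitUniform,
    ← ENNReal.ofReal_mul (by norm_num)]
  norm_num

lemma unitUniform_prod_of_le {q c d : ℝ} (hq : 0 < q)
    (hc : c ∈ Icc (0 : ℝ) 1) (hcd : c ≤ d) :
    (unitUniform.prod unitUniform) {z | z.1 ≤ c ∧ z.1 ^ q * z.2 ≤ d ^ q} =
      ENNReal.ofReal c := by
  have h : (unitUniform.prod unitUniform) {z | z.1 ≤ c ∧ z.1 ^ q * z.2 ≤ d ^ q} =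
      (unitUniform.prod unitUniform) (Iic c ×ˢ univ) := by
    refine measure_congr ?_
    filter_upwards [ae_unitUniform_prod_mem] with z hz
    refine propext ⟨fun h => ⟨h.1, mem_univ _⟩, fun h => ⟨h.1, ?_⟩⟩
    calc z.1 ^ q * z.2 ≤ z.1 ^ q := mul_le_of_le_one_right (rpow_nonneg hz.1.1.le _) hz.2.2
      _ ≤ d ^ q := rpow_le_rpow hz.1.1.le (h.1.trans hcd) hq.le
  rw [h, Measure.prod_prod, unitUniform_Iic hc, measure_univ, mul_one]

lemma unitUniform_prod_of_lt {q c d : ℝ} (hq : 0 < q) (hq1 : q < 1)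
    (hc : c ∈ Icc (0 : ℝ) 1) (hd : d ∈ Icc (0 : ℝ) 1) (hdc : d < c) :
    (unitUniform.prod unitUniform) {z | z.1 ≤ c ∧ z.1 ^ q * z.2 ≤ d ^ q} =
      ENNReal.ofReal (d + d ^ q * ((c ^ (1 - q) - d ^ (1 - q)) / (1 - q))) := by
  have hset : {z : ℝ × ℝ | z.1 ≤ c ∧ z.1 ^ q * z.2 ≤ d ^ q} =
      {z | z.1 ≤ d ∧ z.1 ^ q * z.2 ≤ d ^ q} ∪
        {z | z.1 ∈ Ioc d c ∧ z.1 ^ q * z.2 ≤ d ^ q} := by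
    ext z
    simp only [mem_ofPred_eq, mem_union, mem_Ioc]
    grind
  have hle : MeasurableSet {z : ℝ × ℝ | z.1 ^ q * z.2 ≤ d ^ q} :=
    measurableSet_le (by fun_prop) measurable_const
  have hmeas : MeasurableSet {z : ℝ × ℝ | z.1 ∈ Ioc d c ∧ z.1 ^ q * z.2 ≤ d ^ q} :=
    (measurable_fst measurableSet_Ioc).inter hle
  have hdisj : Disjoint {z : ℝ × ℝ | z.1 ≤ d ∧ z.1 ^ q * z.2 ≤ d ^ q}
      {z | z.1 ∈ Ioc d c ∧ z.1 ^ q * z.2 ≤ d ^ q} :=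
    Set.disjoint_left.2 fun z h1 h2 => h2.1.1.not_ge h1.1
  have hint : IntervalIntegrable (fun w : ℝ => w ^ (-q)) volume d c :=
    intervalIntegral.intervalIntegrable_rpow' (by linarith)
  have hint2 : ∫ w in d..c, w ^ (-q) = (c ^ (1 - q) - d ^ (1 - q)) / (1 - q) := by
    rw [integral_rpow (Or.inl (by linarith))]
    ring_nf
  have hsub : Ioc d c ⊆ Ioc 0 1 := Ioc_subset_Ioc hd.1 hc.2
  have hsecond : (unitUniform.prod unitUniform)
      {z | z.1 ∈ Ioc d c ∧ z.1 ^ q * z.2 ≤ d ^ q} =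
      ENNReal.ofReal (d ^ q * ((c ^ (1 - q) - d ^ (1 - q)) / (1 - q))) := by
    have hsec : ∀ w, unitUniform (Prod.mk w ⁻¹'
        {z : ℝ × ℝ | z.1 ∈ Ioc d c ∧ z.1 ^ q * z.2 ≤ d ^ q}) =
        (Ioc d c).indicator (fun w => ENNReal.ofReal (d ^ q * w ^ (-q))) w := by
      intro w
      by_cases hw : w ∈ Ioc d c
      · have hw0 : 0 < w := (hsub hw).1
        rw [indicator_of_mem hw, ← unitUniform_Iic]
        · congr 1
          ext x
          simp only [mem_preimage, mem_ofPred_eq, hw, true_and, mem_Iic]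
          rw [rpow_neg hw0.le, ← div_eq_mul_inv, le_div_iff₀ (rpow_pos_of_pos hw0 _), mul_comm]
        · refine ⟨mul_nonneg (rpow_nonneg hd.1 _) (rpow_nonneg hw0.le _), ?_⟩
          rw [rpow_neg hw0.le, ← div_eq_mul_inv, div_le_one (rpow_pos_of_pos hw0 _)]
          exact rpow_le_rpow hd.1 hw.1.le hq.le
      · rw [indicator_of_notMem hw]
        exact measure_mono_null (fun x hx => hw hx.1) measure_empty
    rw [Measure.prod_apply hmeas, lintegral_congr hsec, lintegral_indicator measurableSet_Ioc,
      unitUniform, Measure.restrict_restrict_of_subset hsub, ← ofReal_integral_eq_lintegral_ofReal,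
      ← intervalIntegral.integral_of_le hdc.le, intervalIntegral.integral_const_mul, hint2]
    · exact (hint.const_mul _).1
    · filter_upwards [ae_restrict_mem measurableSet_Ioc] with w hw
      exact mul_nonneg (rpow_nonneg hd.1 _) (rpow_nonneg (hsub hw).1.le _)
  rw [hset, measure_union hdisj hmeas, unitUniform_prod_of_le hq hd le_rfl, hsecond,
    ← ENNReal.ofReal_add hd.1]
  rw [← hint2, intervalIntegral.integral_of_le hdc.le]
  exact mul_nonneg (rpow_nonneg hd.1 _) (setIntegral_nonneg measurableSet_Ioc
    fun w hw => rpow_nonneg (hsub hw).1.le _)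

lemma ofReal_mul_unitUniform_prod {q c d : ℝ} (hq : 0 < q) (hq1 : q ≤ 1)
    (hc : c ∈ Icc (0 : ℝ) 1) (hd : d ∈ Icc (0 : ℝ) 1) :
    ENNReal.ofReal (1 - q) *
        (unitUniform.prod unitUniform) {z | z.1 ≤ c ∧ z.1 ^ q * z.2 ≤ d ^ q} =
      ENNReal.ofReal (if c ≤ d then (1 - q) * c else c ^ (1 - q) * d ^ q - q * d) := by
  rcases hq1.eq_or_lt with rfl | hq1
  · simp
  split_ifs with hcd
  · rw [unitUniform_prod_of_le hq hc hcd, ENNReal.ofReal_mul (by linarith)]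
  · rw [unitUniform_prod_of_lt hq hq1 hc hd (not_le.1 hcd), ← ENNReal.ofReal_mul (by linarith)]
    congr 1
    have h1 : d ^ q * d ^ (1 - q) = d := by
      rw [← rpow_add_of_nonneg hd.1 hq.le (by linarith)]
      simp
    have h2 : 1 - q ≠ 0 := by linarith
    field_simp
    linear_combination -h1

lemma measure_Iic_prod_Iic_of_unitSquare {m : Measure (ℝ × ℝ)}
    (h : ∀ᵐ p ∂m, p ∈ Icc (0 : ℝ) 1 ×ˢ Icc (0 : ℝ) 1) (u v : ℝ) :
    m (Iic u ×ˢ Iic v) = m (Icc 0 (min u 1) ×ˢ Icc 0 (min v 1)) := by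
  refine measure_congr ?_
  filter_upwards [h] with p hp
  refine propext ?_
  change p ∈ Iic u ×ˢ Iic v ↔ p ∈ Icc 0 (min u 1) ×ˢ Icc 0 (min v 1)
  simp only [mem_prod, mem_Iic, mem_Icc, le_min_iff] at hp ⊢
  tauto

lemma ext_of_unitSquare {m n : Measure (ℝ × ℝ)} [IsProbabilityMeasure m] [IsProbabilityMeasure n]
    (hm : ∀ᵐ p ∂m, p ∈ Icc (0 : ℝ) 1 ×ˢ Icc (0 : ℝ) 1)
    (hn : ∀ᵐ p ∂n, p ∈ Icc (0 : ℝ) 1 ×ˢ Icc (0 : ℝ) 1)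
    (h : ∀ u ∈ Icc (0 : ℝ) 1, ∀ v ∈ Icc (0 : ℝ) 1,
      m (Icc 0 u ×ˢ Icc 0 v) = n (Icc 0 u ×ˢ Icc 0 v)) : m = n := by
  have hspan : IsCountablySpanning (range (Iic : ℝ → Set ℝ)) :=
    ⟨fun k : ℕ => Iic (k : ℝ), fun k => mem_range_self _, by
      ext x; simpa using exists_nat_ge x⟩
  have hgen : (inferInstance : MeasurableSpace ℝ) =
      MeasurableSpace.generateFrom (range (Iic : ℝ → Set ℝ)) :=
    (BorelSpace.measurable_eq (α := ℝ)).trans (borel_eq_generateFrom_Iic ℝ)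
  refine ext_of_generate_finite (image2 (· ×ˢ ·) (range Iic) (range Iic))
    (generateFrom_eq_prod hgen.symm hgen.symm hspan hspan).symm
    (isPiSystem_Iic.prod isPiSystem_Iic) ?_ (by simp)
  rintro _ ⟨_, ⟨u, rfl⟩, _, ⟨v, rfl⟩, rfl⟩
  change m (Iic u ×ˢ Iic v) = n (Iic u ×ˢ Iic v)
  rw [measure_Iic_prod_Iic_of_unitSquare hm, measure_Iic_prod_Iic_of_unitSquare hn]
  rcases lt_or_ge u 0 with hu | hu
  · simp [Icc_eq_empty_of_lt (min_lt_of_left_lt hu : min u 1 < 0)]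
  rcases lt_or_ge v 0 with hv | hv
  · simp [Icc_eq_empty_of_lt (min_lt_of_left_lt hv : min v 1 < 0)]
  exact h _ ⟨le_min hu zero_le_one, min_le_right _ _⟩ _ ⟨le_min hv zero_le_one, min_le_right _ _⟩

lemma rpow_one_sub_mul_rpow {d q : ℝ} (hd : 0 ≤ d) (hq : q ∈ Icc (0 : ℝ) 1) :
    d ^ (1 - q) * d ^ q = d := by
  rw [← rpow_add_of_nonneg hd (sub_nonneg.2 hq.2) hq.1]
  simp

lemma le_rpow_one_sub_mul_rpow {c d q : ℝ} (hd : 0 ≤ d) (hdc : d ≤ c) (hq : q ∈ Icc (0 : ℝ) 1) :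
    d ≤ c ^ (1 - q) * d ^ q := by
  conv_lhs => rw [← rpow_one_sub_mul_rpow hd hq]
  exact mul_le_mul_of_nonneg_right (rpow_le_rpow hd hdc (sub_nonneg.2 hq.2)) (rpow_nonneg hd _)

/-- The mixture of the laws of `(W ^ p, W ^ q)`, `(W ^ p, W ^ q * X)` and `(W ^ p * X, W ^ q)` with
weights `p + q - 1`, `1 - q` and `1 - p`, where `W` and `X` are independent and uniform. -/
def uniformMixture (p q : ℝ) : Measure (ℝ × ℝ) :=
  ENNReal.ofReal (p + q - 1) • unitUniform.map (fun w => (w ^ p, w ^ q)) +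
    ENNReal.ofReal (1 - q) • (unitUniform.prod unitUniform).map (fun z => (z.1 ^ p, z.1 ^ q * z.2)) +
    ENNReal.ofReal (1 - p) • (unitUniform.prod unitUniform).map (fun z => (z.1 ^ p * z.2, z.1 ^ q))

section uniformMixture

variable {p q : ℝ}

lemma uniformMixture_apply {s : Set (ℝ × ℝ)} (hs : MeasurableSet s) :
    uniformMixture p q s =
      ENNReal.ofReal (p + q - 1) * unitUniform {w | (w ^ p, w ^ q) ∈ s} +
      ENNReal.ofReal (1 - q) *
        (unitUniform.prod unitUniform) {z | (z.1 ^ p, z.1 ^ q * z.2) ∈ s} +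
      ENNReal.ofReal (1 - p) *
        (unitUniform.prod unitUniform) {z | (z.1 ^ p * z.2, z.1 ^ q) ∈ s} := by
  simp only [uniformMixture, Measure.add_apply, Measure.smul_apply, smul_eq_mul]
  rw [Measure.map_apply (by fun_prop) hs, Measure.map_apply (by fun_prop) hs,
    Measure.map_apply (by fun_prop) hs]
  rfl

lemma lintegral_uniformMixture {f : ℝ × ℝ → ENNReal} (hf : Measurable f) :
    ∫⁻ x, f x ∂uniformMixture p q =
      ENNReal.ofReal (p + q - 1) * ∫⁻ w, f (w ^ p, w ^ q) ∂unitUniform +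
      ENNReal.ofReal (1 - q) *
        ∫⁻ z, f (z.1 ^ p, z.1 ^ q * z.2) ∂unitUniform.prod unitUniform +
      ENNReal.ofReal (1 - p) *
        ∫⁻ z, f (z.1 ^ p * z.2, z.1 ^ q) ∂unitUniform.prod unitUniform := by
  simp only [uniformMixture, lintegral_add_measure, lintegral_smul_measure, smul_eq_mul]
  rw [lintegral_map hf (by fun_prop), lintegral_map hf (by fun_prop),
    lintegral_map hf (by fun_prop)]

lemma isProbabilityMeasure_uniformMixture (hp : p ≤ 1) (hq : q ≤ 1) (hpq : 1 ≤ p + q) :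
    IsProbabilityMeasure (uniformMixture p q) := by
  refine ⟨?_⟩
  rw [uniformMixture_apply MeasurableSet.univ]
  simp only [mem_univ, ofPred_true, measure_univ, mul_one]
  rw [← ENNReal.ofReal_add (by linarith) (by linarith),
    ← ENNReal.ofReal_add (by linarith) (by linarith)]
  simp

lemma ae_uniformMixture_mem (hp : 0 ≤ p) (hq : 0 ≤ q) :
    ∀ᵐ x ∂uniformMixture p q, x ∈ Icc (0 : ℝ) 1 ×ˢ Icc (0 : ℝ) 1 := by
  have hI : ∀ {w s : ℝ}, 0 ≤ s → w ∈ Ioc (0 : ℝ) 1 → w ^ s ∈ Icc (0 : ℝ) 1 := fun hs hw =>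
    ⟨rpow_nonneg hw.1.le _, rpow_le_one hw.1.le hw.2 hs⟩
  have hmul : ∀ {x y : ℝ}, x ∈ Icc (0 : ℝ) 1 → y ∈ Ioc (0 : ℝ) 1 → x * y ∈ Icc (0 : ℝ) 1 :=
    fun hx hy => unitInterval.mul_mem hx (Ioc_subset_Icc_self hy)
  have hs : MeasurableSet (Icc (0 : ℝ) 1 ×ˢ Icc (0 : ℝ) 1) :=
    measurableSet_Icc.prod measurableSet_Icc
  simp only [uniformMixture, ae_add_measure_iff]
  refine ⟨⟨Measure.ae_smul_measure ?_ _, Measure.ae_smul_measure ?_ _⟩,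
    Measure.ae_smul_measure ?_ _⟩ <;> refine (ae_map_iff (by fun_prop) hs).2 ?_
  · filter_upwards [ae_unitUniform_mem] with w hw using ⟨hI hp hw, hI hq hw⟩
  · filter_upwards [ae_unitUniform_prod_mem] with z hz
      using ⟨hI hp hz.1, hmul (hI hq hz.1) hz.2⟩
  · filter_upwards [ae_unitUniform_prod_mem] with z hz
      using ⟨hmul (hI hp hz.1) hz.2, hI hq hz.1⟩

lemma uniformMixture_rpow (hp : 0 < p) (hq : 0 < q) (hp1 : p ≤ 1) (hq1 : q ≤ 1)
    (hpq : 1 ≤ p + q) {c d : ℝ} (hc : c ∈ Icc (0 : ℝ) 1) (hd : d ∈ Icc (0 : ℝ) 1) :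
    uniformMixture p q (Icc 0 (c ^ p) ×ˢ Icc 0 (d ^ q)) =
      ENNReal.ofReal (if c ≤ d then c ^ p * d ^ (1 - p) else c ^ (1 - q) * d ^ q) := by
  have h1 : unitUniform {w | (w ^ p, w ^ q) ∈ Icc 0 (c ^ p) ×ˢ Icc 0 (d ^ q)} =
      ENNReal.ofReal (min c d) := by
    rw [← unitUniform_Iic ⟨le_min hc.1 hd.1, min_le_of_left_le hc.2⟩]
    refine measure_congr ?_
    filter_upwards [ae_unitUniform_mem] with w hw
    refine propext ?_
    change (w ^ p, w ^ q) ∈ Icc 0 (c ^ p) ×ˢ Icc 0 (d ^ q) ↔ w ≤ min c d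
    simp [rpow_nonneg hw.1.le, rpow_le_rpow_iff hw.1.le hc.1 hp, rpow_le_rpow_iff hw.1.le hd.1 hq]
  have h2 : (unitUniform.prod unitUniform)
      {z | (z.1 ^ p, z.1 ^ q * z.2) ∈ Icc 0 (c ^ p) ×ˢ Icc 0 (d ^ q)} =
      (unitUniform.prod unitUniform) {z | z.1 ≤ c ∧ z.1 ^ q * z.2 ≤ d ^ q} := by
    refine measure_congr ?_
    filter_upwards [ae_unitUniform_prod_mem] with z hz
    refine propext ?_
    change (z.1 ^ p, z.1 ^ q * z.2) ∈ Icc 0 (c ^ p) ×ˢ Icc 0 (d ^ q) ↔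
      z.1 ≤ c ∧ z.1 ^ q * z.2 ≤ d ^ q
    simp [rpow_nonneg hz.1.1.le, rpow_le_rpow_iff hz.1.1.le hc.1 hp,
      mul_nonneg (rpow_nonneg hz.1.1.le q) hz.2.1.le]
  have h3 : (unitUniform.prod unitUniform)
      {z | (z.1 ^ p * z.2, z.1 ^ q) ∈ Icc 0 (c ^ p) ×ˢ Icc 0 (d ^ q)} =
      (unitUniform.prod unitUniform) {z | z.1 ≤ d ∧ z.1 ^ p * z.2 ≤ c ^ p} := by
    refine measure_congr ?_
    filter_upwards [ae_unitUniform_prod_mem] with z hz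
    refine propext ?_
    change (z.1 ^ p * z.2, z.1 ^ q) ∈ Icc 0 (c ^ p) ×ˢ Icc 0 (d ^ q) ↔
      z.1 ≤ d ∧ z.1 ^ p * z.2 ≤ c ^ p
    simp [rpow_nonneg hz.1.1.le, rpow_le_rpow_iff hz.1.1.le hd.1 hq,
      mul_nonneg (rpow_nonneg hz.1.1.le p) hz.2.1.le, and_comm]
  have hnn : ∀ {a b s : ℝ}, a ∈ Icc (0 : ℝ) 1 → b ∈ Icc (0 : ℝ) 1 → s ∈ Icc (0 : ℝ) 1 →
      0 ≤ if a ≤ b then (1 - s) * a else a ^ (1 - s) * b ^ s - s * b := by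
    intro a b s ha hb hs
    split_ifs with hab
    · exact mul_nonneg (sub_nonneg.2 hs.2) ha.1
    · have := le_rpow_one_sub_mul_rpow hb.1 (not_le.1 hab).le hs
      nlinarith [mul_le_mul_of_nonneg_right hs.2 hb.1]
  have hm : 0 ≤ (p + q - 1) * min c d := mul_nonneg (by linarith) (le_min hc.1 hd.1)
  have hpI : p ∈ Icc (0 : ℝ) 1 := ⟨hp.le, hp1⟩
  have hqI : q ∈ Icc (0 : ℝ) 1 := ⟨hq.le, hq1⟩
  rw [uniformMixture_apply (measurableSet_Icc.prod measurableSet_Icc), h1, h2, h3,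
    ofReal_mul_unitUniform_prod hq hq1 hc hd, ofReal_mul_unitUniform_prod hp hp1 hd hc,
    ← ENNReal.ofReal_mul (by linarith), ← ENNReal.ofReal_add hm (hnn hc hd hqI),
    ← ENNReal.ofReal_add (add_nonneg hm (hnn hc hd hqI)) (hnn hd hc hpI)]
  congr 1
  rcases lt_trichotomy c d with h | rfl | h
  · rw [if_pos h.le, if_neg h.not_ge, if_pos h.le, min_eq_left h.le]
    ring
  · have := rpow_one_sub_mul_rpow hc.1 hpI
    simp only [le_refl, if_true, min_self]
    linear_combination -this
  · rw [if_neg h.not_ge, if_pos h.le, if_neg h.not_ge, min_eq_right h.le]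
    ring

end uniformMixture

/-- The Marshall–Olkin copula with parameters `α` and `β`. -/
def marshallOlkin (α β u v : ℝ) : ℝ := min (u ^ (1 - α) * v) (u * v ^ (1 - β))

lemma marshallOlkin_comm (α β u v : ℝ) : marshallOlkin α β u v = marshallOlkin β α v u := by
  simp only [marshallOlkin, min_comm, mul_comm]

lemma measurable_marshallOlkin (α β : ℝ) :
    Measurable fun x : ℝ × ℝ => marshallOlkin α β x.1 x.2 := by
  unfold marshallOlkin
  fun_prop

lemma marshallOlkin_nonneg (α β : ℝ) {u v : ℝ} (hu : 0 ≤ u) (hv : 0 ≤ v) :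
    0 ≤ marshallOlkin α β u v :=
  le_min (mul_nonneg (rpow_nonneg hu _) hv) (mul_nonneg hu (rpow_nonneg hv _))

lemma marshallOlkin_rpow_mul {α β p q w x : ℝ} (hβ : β ∈ Icc (0 : ℝ) 1)
    (hα : p * (1 - α) + q = 1) (hβ' : p + q * (1 - β) = 1) (hw : 0 < w) (hx : x ∈ Ioc (0 : ℝ) 1) :
    marshallOlkin α β (w ^ p) (w ^ q * x) = w * x := by
  have h1 : (w ^ p) ^ (1 - α) * (w ^ q * x) = w * x := by
    rw [← rpow_mul hw.le, ← mul_assoc, ← rpow_add hw, hα, rpow_one]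
  have h2 : w ^ p * (w ^ q * x) ^ (1 - β) = w * x ^ (1 - β) := by
    rw [mul_rpow (rpow_nonneg hw.le _) hx.1.le, ← rpow_mul hw.le, ← mul_assoc, ← rpow_add hw, hβ',
      rpow_one]
  rw [marshallOlkin, h1, h2, min_eq_left]
  refine mul_le_mul_of_nonneg_left ?_ hw.le
  conv_lhs => rw [← rpow_one x]
  exact rpow_le_rpow_of_exponent_ge hx.1 hx.2 (by linarith [hβ.1])

lemma lintegral_marshallOlkin_uniformMixture {α β p q : ℝ} (hα : α ∈ Icc (0 : ℝ) 1)
    (hβ : β ∈ Icc (0 : ℝ) 1) (hp : p ≤ 1) (hq : q ≤ 1) (hpq : 1 ≤ p + q)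
    (hα' : p * (1 - α) + q = 1) (hβ' : p + q * (1 - β) = 1) :
    ∫⁻ x, ENNReal.ofReal (marshallOlkin α β x.1 x.2) ∂uniformMixture p q =
      ENNReal.ofReal ((p + q) / 4) := by
  have h1 : ∫⁻ w, ENNReal.ofReal (marshallOlkin α β (w ^ p) (w ^ q)) ∂unitUniform =
      ENNReal.ofReal (1 / 2) := by
    rw [← lintegral_unitUniform]
    refine lintegral_congr_ae ?_
    filter_upwards [ae_unitUniform_mem] with w hw
    simpa using congrArg ENNReal.ofReal
      (marshallOlkin_rpow_mul hβ hα' hβ' hw.1 (right_mem_Ioc.2 (zero_lt_one' ℝ)))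
  have h2 : ∫⁻ z, ENNReal.ofReal (marshallOlkin α β (z.1 ^ p) (z.1 ^ q * z.2))
      ∂unitUniform.prod unitUniform = ENNReal.ofReal (1 / 4) := by
    rw [← lintegral_unitUniform_prod_mul]
    refine lintegral_congr_ae ?_
    filter_upwards [ae_unitUniform_prod_mem] with z hz
    rw [marshallOlkin_rpow_mul hβ hα' hβ' hz.1.1 hz.2]
  have h3 : ∫⁻ z, ENNReal.ofReal (marshallOlkin α β (z.1 ^ p * z.2) (z.1 ^ q))
      ∂unitUniform.prod unitUniform = ENNReal.ofReal (1 / 4) := by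
    rw [← lintegral_unitUniform_prod_mul]
    refine lintegral_congr_ae ?_
    filter_upwards [ae_unitUniform_prod_mem] with z hz
    rw [marshallOlkin_comm, marshallOlkin_rpow_mul hα (by linarith) (by linarith) hz.1.1 hz.2]
  rw [lintegral_uniformMixture (measurable_marshallOlkin α β).ennreal_ofReal, h1, h2, h3,
    ← ENNReal.ofReal_mul (by linarith), ← ENNReal.ofReal_mul (by linarith),
    ← ENNReal.ofReal_mul (by linarith), ← ENNReal.ofReal_add (by linarith) (by linarith),
    ← ENNReal.ofReal_add (by linarith) (by linarith)]
  congr 1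
  ring

lemma marshallOlkin_rpow_rpow {α β p q c d : ℝ} (hp : p ∈ Icc (0 : ℝ) 1) (hq : q ∈ Icc (0 : ℝ) 1)
    (hpq : 1 ≤ p + q) (hα : p * (1 - α) + q = 1) (hβ : p + q * (1 - β) = 1)
    (hc : 0 ≤ c) (hd : 0 ≤ d) :
    marshallOlkin α β (c ^ p) (d ^ q) =
      if c ≤ d then c ^ p * d ^ (1 - p) else c ^ (1 - q) * d ^ q := by
  have h1 : (c ^ p) ^ (1 - α) = c ^ (1 - q) := by
    rw [← rpow_mul hc]; congr 1; linarith
  have h2 : (d ^ q) ^ (1 - β) = d ^ (1 - p) := by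
    rw [← rpow_mul hd]; congr 1; linarith
  have hcp : c ^ p = c ^ (1 - q) * c ^ (p + q - 1) := by
    rw [← rpow_add_of_nonneg hc (sub_nonneg.2 hq.2) (by linarith)]; congr 1; ring
  have hdq : d ^ q = d ^ (p + q - 1) * d ^ (1 - p) := by
    rw [← rpow_add_of_nonneg hd (by linarith) (sub_nonneg.2 hp.2)]; congr 1; ring
  rw [marshallOlkin, h1, h2]
  have hc' := rpow_nonneg hc (1 - q)
  have hd' := rpow_nonneg hd (1 - p)
  split_ifs with h
  · refine min_eq_right ?_
    rw [hcp, hdq, mul_assoc]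
    gcongr
  · refine min_eq_left ?_
    rw [hcp, hdq, mul_assoc]
    have := (not_le.1 h).le
    gcongr

lemma uniformMixture_Icc_prod_Icc {α β p q : ℝ} (hp : p ∈ Icc (0 : ℝ) 1) (hq : q ∈ Icc (0 : ℝ) 1)
    (hp0 : 0 < p) (hq0 : 0 < q) (hpq : 1 ≤ p + q) (hα : p * (1 - α) + q = 1)
    (hβ : p + q * (1 - β) = 1) {u v : ℝ} (hu : u ∈ Icc (0 : ℝ) 1) (hv : v ∈ Icc (0 : ℝ) 1) :
    uniformMixture p q (Icc 0 u ×ˢ Icc 0 v) = ENNReal.ofReal (marshallOlkin α β u v) := by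
  have hroot : ∀ {x s : ℝ}, x ∈ Icc (0 : ℝ) 1 → 0 < s → ∃ c ∈ Icc (0 : ℝ) 1, c ^ s = x :=
    fun {x s} hx hs => ⟨x ^ s⁻¹, ⟨rpow_nonneg hx.1 _, rpow_le_one hx.1 hx.2 (inv_nonneg.2 hs.le)⟩,
      rpow_inv_rpow hx.1 hs.ne'⟩
  obtain ⟨c, hc, rfl⟩ := hroot hu hp0
  obtain ⟨d, hd, rfl⟩ := hroot hv hq0
  rw [uniformMixture_rpow hp0 hq0 hp.2 hq.2 hpq hc hd,
    marshallOlkin_rpow_rpow hp hq hpq hα hβ hc.1 hd.1]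

lemma unitUniform_prod_Icc_prod_Icc {u v : ℝ} (hu : u ∈ Icc (0 : ℝ) 1) (hv : v ∈ Icc (0 : ℝ) 1) :
    (unitUniform.prod unitUniform) (Icc 0 u ×ˢ Icc 0 v) = ENNReal.ofReal (u * v) := by
  have h : ∀ {x : ℝ}, x ∈ Icc (0 : ℝ) 1 → unitUniform (Icc 0 x) = ENNReal.ofReal x := by
    intro x hx
    rw [← unitUniform_Iic hx]
    refine measure_congr ?_
    filter_upwards [ae_unitUniform_mem] with w hw
    exact propext ⟨fun h => h.2, fun h => ⟨hw.1.le, h⟩⟩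
  rw [Measure.prod_prod, h hu, h hv, ENNReal.ofReal_mul hu.1]

lemma marshallOlkin_zero_right {α u v : ℝ} (hα : α ∈ Icc (0 : ℝ) 1) (hu : u ∈ Icc (0 : ℝ) 1)
    (hv : v ∈ Icc (0 : ℝ) 1) : marshallOlkin α 0 u v = u * v := by
  rw [marshallOlkin, sub_zero, rpow_one]
  refine min_eq_right (mul_le_mul_of_nonneg_right ?_ hv.1)
  rcases hu.1.eq_or_lt with rfl | hu0
  · exact rpow_nonneg le_rfl _
  · conv_lhs => rw [← rpow_one u]
    exact rpow_le_rpow_of_exponent_ge hu0 hu.2 (by linarith [hα.1])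

lemma uniformMixture_zero_one :
    uniformMixture 0 1 = unitUniform.prod unitUniform := by
  have h : (unitUniform.prod unitUniform).map (fun z : ℝ × ℝ => (z.2, z.1)) =
    unitUniform.prod unitUniform := Measure.prod_swap
  simp [uniformMixture, h]

lemma uniformMixture_one_zero :
    uniformMixture 1 0 = unitUniform.prod unitUniform := by
  simp [uniformMixture]

theorem stmt_14 (α β : ℝ) (hα : α ∈ Set.Icc (0:ℝ) 1) (hβ : β ∈ Set.Icc (0:ℝ) 1)
    (hne : (α, β) ≠ (0, 0)) (C : ℝ → ℝ → ℝ)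
    (hCdef : ∀ u v : ℝ, u ∈ Set.Icc (0:ℝ) 1 → v ∈ Set.Icc (0:ℝ) 1 →
      C u v = min (u ^ (1 - α) * v) (u * v ^ (1 - β)))
    (μ : Measure (ℝ × ℝ)) [IsProbabilityMeasure μ]
    (hμ : ∀ u v : ℝ, u ∈ Set.Icc (0:ℝ) 1 → v ∈ Set.Icc (0:ℝ) 1 →
      μ (Set.Icc 0 u ×ˢ Set.Icc 0 v) = ENNReal.ofReal (C u v)) :
    4 * (∫ p : ℝ × ℝ, C p.1 p.2 ∂μ) - 1 = α * β / (α - α * β + β) := by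
  have hD : 0 < α - α * β + β := by
    have h : 0 < α ∨ 0 < β := by
      by_contra! h
      exact hne (Prod.ext (le_antisymm h.1 hα.1) (le_antisymm h.2 hβ.1))
    rcases h with h | h
    · nlinarith [mul_nonneg hα.1 (sub_nonneg.2 hβ.2), mul_nonneg hβ.1 (sub_nonneg.2 hα.2), hβ.1,
        hβ.2, mul_nonneg hβ.1 hα.1]
    · nlinarith [mul_nonneg hα.1 (sub_nonneg.2 hβ.2)]
  obtain ⟨p, hp⟩ : ∃ p, p = β / (α - α * β + β) := ⟨_, rfl⟩
  obtain ⟨q, hq⟩ : ∃ q, q = α / (α - α * β + β) := ⟨_, rfl⟩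
  have hpI : p ∈ Icc (0 : ℝ) 1 := by
    rw [hp]
    exact ⟨div_nonneg hβ.1 hD.le, (div_le_one hD).2 (by nlinarith [hα.1, hβ.2])⟩
  have hqI : q ∈ Icc (0 : ℝ) 1 := by
    rw [hq]
    exact ⟨div_nonneg hα.1 hD.le, (div_le_one hD).2 (by nlinarith [hβ.1, hα.2])⟩
  have hinv := mul_inv_cancel₀ hD.ne'
  have hsum : p + q = 1 + α * β / (α - α * β + β) := by
    simp only [hp, hq, div_eq_mul_inv]
    linear_combination hinv
  have hα' : p * (1 - α) + q = 1 := by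
    simp only [hp, hq, div_eq_mul_inv]
    linear_combination hinv
  have hβ' : p + q * (1 - β) = 1 := by
    simp only [hp, hq, div_eq_mul_inv]
    linear_combination hinv
  have hpq : 1 ≤ p + q := by
    rw [hsum]
    linarith [div_nonneg (mul_nonneg hα.1 hβ.1) hD.le]
  have hmem : ∀ᵐ x ∂μ, x ∈ Icc (0 : ℝ) 1 ×ˢ Icc (0 : ℝ) 1 := by
    refine (prob_compl_eq_zero_iff (measurableSet_Icc.prod measurableSet_Icc)).2 ?_
    have h1 : (1 : ℝ) ∈ Icc (0 : ℝ) 1 := right_mem_Icc.2 zero_le_one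
    rw [hμ 1 1 h1 h1, hCdef 1 1 h1 h1]
    simp
  have hcdf : ∀ u ∈ Icc (0 : ℝ) 1, ∀ v ∈ Icc (0 : ℝ) 1, uniformMixture p q (Icc 0 u ×ˢ Icc 0 v) =
      ENNReal.ofReal (marshallOlkin α β u v) := by
    intro u hu v hv
    rcases hα.1.eq_or_lt with rfl | hα0
    · have h0 : q = 0 := by simp [hq]
      have h1 : p = 1 := by simpa [h0] using hβ'
      rw [h0, h1, uniformMixture_one_zero, unitUniform_prod_Icc_prod_Icc hu hv, marshallOlkin_comm,
        marshallOlkin_zero_right hβ hv hu, mul_comm]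
    rcases hβ.1.eq_or_lt with rfl | hβ0
    · have h0 : p = 0 := by simp [hp]
      have h1 : q = 1 := by simpa [h0] using hα'
      rw [h0, h1, uniformMixture_zero_one, unitUniform_prod_Icc_prod_Icc hu hv,
        marshallOlkin_zero_right hα hu hv]
    exact uniformMixture_Icc_prod_Icc hpI hqI (hp ▸ div_pos hβ0 hD) (hq ▸ div_pos hα0 hD) hpq
      hα' hβ' hu hv
  have : IsProbabilityMeasure (uniformMixture p q) :=
    isProbabilityMeasure_uniformMixture hpI.2 hqI.2 hpq
  have hμeq : μ = uniformMixture p q := by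
    refine ext_of_unitSquare hmem (ae_uniformMixture_mem hpI.1 hqI.1) fun u hu v hv => ?_
    rw [hcdf u hu v hv, hμ u v hu hv, hCdef u v hu hv, marshallOlkin]
  have hint : ∫ x : ℝ × ℝ, C x.1 x.2 ∂μ = (p + q) / 4 := by
    have h : ∫ x : ℝ × ℝ, C x.1 x.2 ∂μ = ∫ x : ℝ × ℝ, marshallOlkin α β x.1 x.2 ∂μ := by
      refine integral_congr_ae ?_
      filter_upwards [hmem] with x hx using hCdef _ _ hx.1 hx.2
    rw [h, integral_eq_lintegral_of_nonneg_ae _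
      (measurable_marshallOlkin α β).aestronglyMeasurable, hμeq,
      lintegral_marshallOlkin_uniformMixture hα hβ hpI.2 hqI.2 hpq hα' hβ',
      ENNReal.toReal_ofReal (by linarith)]
    filter_upwards [hmem] with x hx using marshallOlkin_nonneg _ _ hx.1.1 hx.2.1
  rw [hint, hsum]
  ring
end
end
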